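/- Every 4-regular simple graph that contains a cycle of length 3 admits a strong edge-coloring using at most 21 colors. -/

import Mathlib

/-- Two edges of `G` conflict in a strong edge-coloring: they share an endpoint,
or some endpoint of one is adjacent in `G` to some endpoint of the other. -/
def StrongConflict {V : Type*} (G : SimpleGraph V) (e f : Sym2 V) : Prop :=
  (∃ v, v ∈ e ∧ v ∈ f) ∨ (∃ u v, u ∈ e ∧ v ∈ f ∧ G.Adj u v)

/-- A strong edge-coloring of `G` with `k` colors: conflicting distinct edges
receive different colors. -/
def IsStrongEdgeColoring {V : Type*} (G : SimpleGraph V) {k : ℕ}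
    (C : G.edgeSet → Fin k) : Prop :=
  ∀ e f : G.edgeSet, e ≠ f → StrongConflict G (e : Sym2 V) (f : Sym2 V) → C e ≠ C f


namespace StrongEdge

open Finset

lemma strongConflict_symm {V : Type*} {G : SimpleGraph V} {e f : Sym2 V}
    (h : StrongConflict G e f) : StrongConflict G f e := by
  rcases h with ⟨v, h1, h2⟩ | ⟨u, v, h1, h2, h3⟩
  · exact Or.inl ⟨v, h2, h1⟩
  · exact Or.inr ⟨v, u, h2, h1, h3.symm⟩

variable {V : Type*} [Fintype V] [DecidableEq V] (G : SimpleGraph V) [DecidableRel G.Adj]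

open Classical in
/-- The edges of `G` other than `e` that conflict with `e`. -/
noncomputable def nbhd (e : Sym2 V) : Finset (Sym2 V) :=
  G.edgeFinset.filter fun f => f ≠ e ∧ StrongConflict G e f

/-- `ψ` is a strong edge-coloring of the edges in `B`. -/
def ValidOn (B : Finset (Sym2 V)) (ψ : Sym2 V → Fin 21) : Prop :=
  ∀ e ∈ B, ∀ f ∈ B, f ∈ nbhd G e → ψ e ≠ ψ f

variable {G}

lemma mem_nbhd {e f : Sym2 V} :
    f ∈ nbhd G e ↔ f ∈ G.edgeSet ∧ f ≠ e ∧ StrongConflict G e f := by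
  simp [nbhd]

lemma mem_nbhd_comm {e f : Sym2 V} (he : e ∈ G.edgeSet) (h : f ∈ nbhd G e) : e ∈ nbhd G f := by
  rw [mem_nbhd] at *
  exact ⟨he, h.2.1.symm, strongConflict_symm h.2.2⟩

lemma mem_nbhd_of_vertex {x y z : V} {f : Sym2 V} (hf : f ∈ G.edgeSet) (hne : f ≠ s(x, y))
    (hz : z ∈ f) (h : z = x ∨ z = y ∨ G.Adj x z ∨ G.Adj y z) : f ∈ nbhd G s(x, y) := by
  rw [mem_nbhd]
  refine ⟨hf, hne, ?_⟩
  rcases h with rfl | rfl | h | h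
  · exact Or.inl ⟨z, by simp, hz⟩
  · exact Or.inl ⟨z, by simp, hz⟩
  · exact Or.inr ⟨x, z, by simp, hz, h⟩
  · exact Or.inr ⟨y, z, by simp, hz, h⟩

lemma mem_nbhd_edges {x y a b : V} :
    s(a, b) ∈ nbhd G s(x, y) ↔ G.Adj a b ∧ s(a, b) ≠ s(x, y) ∧
      ((a = x ∨ a = y ∨ G.Adj x a ∨ G.Adj y a) ∨ (b = x ∨ b = y ∨ G.Adj x b ∨ G.Adj y b)) := by
  constructor
  · intro h
    rw [mem_nbhd] at h
    refine ⟨h.1, h.2.1, ?_⟩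
    rcases h.2.2 with ⟨v, h1, h2⟩ | ⟨u, v, h1, h2, h3⟩
    · simp only [Sym2.mem_iff] at h1 h2
      grind
    · simp only [Sym2.mem_iff] at h1 h2
      grind
  · rintro ⟨h1, h2, h3 | h3⟩
    · exact mem_nbhd_of_vertex h1 h2 (by simp) h3
    · exact mem_nbhd_of_vertex h1 h2 (by simp) h3

lemma mem_incidence {v : V} {e : Sym2 V} :
    e ∈ G.incidenceFinset v ↔ e ∈ G.edgeSet ∧ v ∈ e := by
  rw [SimpleGraph.mem_incidenceFinset]; rfl

lemma nbhd_subset {x y : V} {f : Sym2 V} (h : f ∈ nbhd G s(x, y)) :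
    ∃ u, ((G.Adj x u ∧ u ≠ y) ∨ (G.Adj y u ∧ u ≠ x)) ∧ f ∈ G.incidenceFinset u := by
  induction f with | _ a b =>
  obtain ⟨hab, hne, h⟩ := mem_nbhd_edges.1 h
  have key : ∀ a b : V, G.Adj a b → s(a, b) ≠ s(x, y) →
      (a = x ∨ a = y ∨ G.Adj x a ∨ G.Adj y a) →
      ∃ u, ((G.Adj x u ∧ u ≠ y) ∨ (G.Adj y u ∧ u ≠ x)) ∧ (u = a ∨ u = b) := by
    intro a b hab hne h
    simp only [ne_eq, Sym2.eq_iff] at hne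
    by_cases h1 : a = x
    · exact ⟨b, by grind, by simp⟩
    · by_cases h2 : a = y
      · exact ⟨b, by grind, by simp⟩
      · exact ⟨a, by grind, by simp⟩
  rcases h with h | h
  · obtain ⟨u, h1, h2⟩ := key a b hab hne h
    exact ⟨u, h1, mem_incidence.2 ⟨hab, by simpa using h2⟩⟩
  · obtain ⟨u, h1, h2⟩ := key b a hab.symm (by rwa [Sym2.eq_swap]) h
    exact ⟨u, h1, mem_incidence.2 ⟨hab, by simpa using h2.symm⟩⟩

/-- The neighborhood of a vertex, with one neighbor singled out. -/
lemma exists_neighbors (hreg : ∀ v, G.degree v = 4) {x y : V} (h : G.Adj x y) :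
    ∃ a b c, a ≠ y ∧ b ≠ y ∧ c ≠ y ∧ a ≠ b ∧ a ≠ c ∧ b ≠ c ∧
      ∀ z, G.Adj x z ↔ z = y ∨ z = a ∨ z = b ∨ z = c := by
  have h1 : ((G.neighborFinset x).erase y).card = 3 := by
    rw [Finset.card_erase_of_mem (by simpa using h), G.card_neighborFinset_eq_degree, hreg]
  obtain ⟨a, b, c, hab, hac, hbc, hs⟩ := Finset.card_eq_three.1 h1
  have hm : ∀ z, (z ≠ y ∧ G.Adj x z) ↔ z = a ∨ z = b ∨ z = c := by
    intro z
    have := Finset.ext_iff.1 hs z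
    simpa using this
  refine ⟨a, b, c, ((hm a).2 (by simp)).1, ((hm b).2 (by simp)).1, ((hm c).2 (by simp)).1,
    hab, hac, hbc, fun z => ?_⟩
  by_cases hz : z = y
  · simp [hz, h]
  · have := hm z
    simp only [ne_eq, hz, not_false_eq_true, true_and] at this
    simp [this, hz]

lemma exists_neighbors' (hreg : ∀ v, G.degree v = 4) {x y z : V} (h : G.Adj x y) (h' : G.Adj x z)
    (hyz : y ≠ z) :
    ∃ a b, a ≠ y ∧ b ≠ y ∧ a ≠ z ∧ b ≠ z ∧ a ≠ b ∧
      ∀ w, G.Adj x w ↔ w = y ∨ w = z ∨ w = a ∨ w = b := by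
  obtain ⟨a, b, c, h1, h2, h3, h4, h5, h6, h7⟩ := exists_neighbors hreg h
  have := (h7 z).1 h'
  rcases this with rfl | rfl | rfl | rfl
  · exact absurd rfl hyz
  · exact ⟨b, c, by grind⟩
  · exact ⟨a, c, by grind⟩
  · exact ⟨a, b, by grind⟩

lemma card_nbhd_sdiff_le {x y a b c a' b' c' : V} (T : Finset (Sym2 V))
    (hx : ∀ z, G.Adj x z → z = y ∨ z = a ∨ z = b ∨ z = c)
    (hy : ∀ z, G.Adj y z → z = x ∨ z = a' ∨ z = b' ∨ z = c') :
    (nbhd G s(x, y) \ T).card ≤ (G.incidenceFinset a \ T).card + (G.incidenceFinset b \ T).card +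
      (G.incidenceFinset c \ T).card + (G.incidenceFinset a' \ T).card +
      (G.incidenceFinset b' \ T).card + (G.incidenceFinset c' \ T).card := by
  have hsub : nbhd G s(x, y) \ T ⊆ (G.incidenceFinset a \ T) ∪ (G.incidenceFinset b \ T) ∪
      (G.incidenceFinset c \ T) ∪ (G.incidenceFinset a' \ T) ∪
      (G.incidenceFinset b' \ T) ∪ (G.incidenceFinset c' \ T) := by
    intro f hf
    rw [Finset.mem_sdiff] at hf
    obtain ⟨u, hu, hfu⟩ := nbhd_subset hf.1
    simp only [Finset.mem_union, Finset.mem_sdiff]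
    rcases hu with ⟨h1, h2⟩ | ⟨h1, h2⟩
    · have := hx u h1
      grind
    · have := hy u h1
      grind
  refine (Finset.card_le_card hsub).trans ?_
  refine (Finset.card_union_le _ _).trans ?_
  gcongr
  refine (Finset.card_union_le _ _).trans ?_
  gcongr
  refine (Finset.card_union_le _ _).trans ?_
  gcongr
  refine (Finset.card_union_le _ _).trans ?_
  gcongr
  exact Finset.card_union_le _ _

lemma card_incidence_sdiff_le (hreg : ∀ v, G.degree v = 4) (v : V) (T D : Finset (Sym2 V))
    (h1 : D ⊆ G.incidenceFinset v) (h2 : D ⊆ T) :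
    (G.incidenceFinset v \ T).card + D.card ≤ 4 := by
  have h3 : (G.incidenceFinset v \ T).card ≤ (G.incidenceFinset v \ D).card :=
    Finset.card_le_card (Finset.sdiff_subset_sdiff le_rfl h2)
  have h4 := Finset.card_sdiff_add_card_eq_card h1
  rw [G.card_incidenceFinset_eq_degree, hreg] at h4
  omega

lemma card_incidence_sdiff_le_four (hreg : ∀ v, G.degree v = 4) (v : V) (T : Finset (Sym2 V)) :
    (G.incidenceFinset v \ T).card ≤ 4 := by
  simpa using card_incidence_sdiff_le hreg v T ∅ (by simp) (by simp)

lemma card_incidence_sdiff_add_le (hreg : ∀ v, G.degree v = 4) (v : V) (T : Finset (Sym2 V))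
    (N : Finset V) (hN : ∀ y ∈ N, G.Adj v y ∧ s(v, y) ∈ T) :
    (G.incidenceFinset v \ T).card + N.card ≤ 4 := by
  rw [← Finset.card_image_of_injective N (f := fun y => s(v, y)) fun a b h => by grind]
  refine card_incidence_sdiff_le hreg v T _ ?_ ?_
  · intro e he
    obtain ⟨y, hy, rfl⟩ := Finset.mem_image.1 he
    exact mem_incidence.2 ⟨(hN y hy).1, by simp⟩
  · intro e he
    obtain ⟨y, hy, rfl⟩ := Finset.mem_image.1 he
    exact (hN y hy).2

lemma card_nbhd_le (hreg : ∀ v, G.degree v = 4) {x y : V} (h : G.Adj x y) :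
    (nbhd G s(x, y)).card ≤ 24 := by
  obtain ⟨a, b, c, -, -, -, -, -, -, hx⟩ := exists_neighbors hreg h
  obtain ⟨a', b', c', -, -, -, -, -, -, hy⟩ := exists_neighbors hreg h.symm
  have := card_nbhd_sdiff_le (G := G) ∅ (fun z => (hx z).1) (fun z => (hy z).1)
  have h4 := fun v => card_incidence_sdiff_le_four hreg v ∅
  simp only [Finset.sdiff_empty] at this h4
  have := h4 a; have := h4 b; have := h4 c; have := h4 a'; have := h4 b'; have := h4 c'
  omega

/-- `A` absorbs every edge outside `P` that can be colored, once the edges outside `A` have been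
colored in a way that agrees with `ψ₀` on `P`. -/
def Closed (G : SimpleGraph V) [DecidableRel G.Adj] (P : Finset (Sym2 V)) (ψ₀ : Sym2 V → Fin 21)
    (A : Finset (Sym2 V)) : Prop :=
  ∀ e ∈ G.edgeSet, e ∉ P → ∀ D : Finset (Sym2 V), (nbhd G e \ D).card ≤ 20 →
    (∀ d ∈ D, d ∈ A ∨ d ∈ P ∧ ∃ d' ∈ nbhd G e \ D, d' ∈ P ∧ ψ₀ d' = ψ₀ d) → e ∈ A

lemma exists_color {S : Finset (Fin 21)} (h : S.card ≤ 20) : ∃ κ, κ ∉ S := by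
  by_contra! hc
  have : S = Finset.univ := Finset.eq_univ_iff_forall.2 hc
  rw [this] at h
  simp at h

lemma validOn_update {B : Finset (Sym2 V)} {ψ : Sym2 V → Fin 21} {e : Sym2 V} {κ : Fin 21}
    (hB : ∀ f ∈ B, f ∈ G.edgeSet) (hψ : ValidOn G (B.erase e) ψ)
    (hκ : ∀ f ∈ nbhd G e, f ∈ B → ψ f ≠ κ) : ValidOn G B (Function.update ψ e κ) := by
  intro f hf g hg hfg
  have hne : g ≠ f := (mem_nbhd.1 hfg).2.1
  by_cases h1 : f = e
  · subst h1
    rw [Function.update_self, Function.update_of_ne hne]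
    exact (hκ g hfg hg).symm
  · rw [Function.update_of_ne h1]
    by_cases h2 : g = e
    · subst h2
      rw [Function.update_self]
      exact hκ f (mem_nbhd_comm (hB f hf) hfg) hf
    · rw [Function.update_of_ne h2]
      exact hψ f (Finset.mem_erase.2 ⟨h1, hf⟩) g (Finset.mem_erase.2 ⟨h2, hg⟩) hfg

/-- Greedy coloring towards `T`, starting from a coloring `ψ₀` of `P`. -/
theorem exists_validOn_of_closed (P T : Finset (Sym2 V)) (ψ₀ : Sym2 V → Fin 21)
    (hP : ValidOn G P ψ₀) (hPT : Disjoint T P)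
    (h : ∀ A, T ⊆ A → Closed G P ψ₀ A → ∀ e ∈ G.edgeSet, e ∉ P → e ∈ A) :
    ∃ ψ, ValidOn G (G.edgeFinset \ T) ψ := by
  classical
  let claim : Finset (Sym2 V) → Prop := fun A => ∀ ψ, ValidOn G (G.edgeFinset \ A) ψ →
    (∀ e ∈ P, ψ e = ψ₀ e) → ∃ ψ', ValidOn G (G.edgeFinset \ T) ψ'
  obtain ⟨A, hA, hmax⟩ := Finset.exists_max_image
    (Finset.univ.filter fun A : Finset (Sym2 V) => T ⊆ A ∧ Disjoint A P ∧ claim A) Finset.card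
    ⟨T, by simpa using ⟨hPT, fun ψ hψ _ => ⟨ψ, hψ⟩⟩⟩
  simp only [Finset.mem_filter, Finset.mem_univ, true_and] at hA hmax
  obtain ⟨hTA, hAP, hcl⟩ := hA
  have hclosed : Closed G P ψ₀ A := by
    intro e he heP D hD hdup
    by_contra heA
    have hlt := hmax (insert e A) ⟨hTA.trans (Finset.subset_insert _ _),
      Finset.disjoint_insert_left.2 ⟨heP, hAP⟩, ?_⟩
    · rw [Finset.card_insert_of_notMem heA] at hlt
      omega
    · intro ψ hψ hag
      obtain ⟨κ, hκ⟩ := exists_color ((Finset.card_image_le (f := ψ)).trans hD)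
      refine hcl (Function.update ψ e κ) (validOn_update (fun f hf => ?_) ?_ ?_) ?_
      · exact SimpleGraph.mem_edgeFinset.1 (Finset.mem_sdiff.1 hf).1
      · rwa [← Finset.sdiff_insert]
      · intro f hf hfB hfκ
        apply hκ
        rw [← hfκ, Finset.mem_image]
        by_cases hfD : f ∈ D
        · rcases hdup f hfD with h1 | ⟨h1, d', hd', hd'P, heq⟩
          · exact absurd h1 (Finset.mem_sdiff.1 hfB).2
          · exact ⟨d', hd', by rw [hag _ hd'P, heq, hag _ h1]⟩
        · exact ⟨f, by simp [hf, hfD], rfl⟩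
      · intro f hf
        rw [Function.update_of_ne (by rintro rfl; exact heP hf), hag f hf]
  refine hcl ψ₀ (fun e he f hf hef => ?_) (fun _ _ => rfl)
  have key : ∀ e ∈ G.edgeFinset \ A, e ∈ P := by
    intro e he
    rw [Finset.mem_sdiff, SimpleGraph.mem_edgeFinset] at he
    by_contra heP
    exact he.2 (h A hTA hclosed e he.1 heP)
  exact hP e (key e he) f (key f hf) hef

end StrongEdge

namespace StrongEdge

open Finset

/-- All edges at `z` belong to `A`. -/
def Full {V : Type*} (G : SimpleGraph V) (A : Finset (Sym2 V)) (z : V) : Prop :=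
  ∀ y, G.Adj z y → s(z, y) ∈ A

lemma mem_of_forall_full {V : Type*} {G : SimpleGraph V} {A : Finset (Sym2 V)}
    (h : ∀ x, Full G A x) : ∀ e ∈ G.edgeSet, e ∈ A := by
  intro e he
  induction e with | _ a b => exact h a b he

variable {V : Type*} [Fintype V] [DecidableEq V] {G : SimpleGraph V} [DecidableRel G.Adj]
  {P A : Finset (Sym2 V)} {ψ₀ : Sym2 V → Fin 21}

lemma Full.incidence_subset {z : V} (h : Full G A z) : G.incidenceFinset z ⊆ A := by
  intro e he
  obtain ⟨h1, h2⟩ := mem_incidence.1 he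
  obtain ⟨y, rfl⟩ := Sym2.mem_iff_exists.1 h2
  exact h y h1

lemma Closed.mem_of_card_le (hA : Closed G P ψ₀ A) {x y : V} (h : G.Adj x y) (hP : s(x, y) ∉ P)
    (D : Finset (Sym2 V)) (hD : D ⊆ A) (hc : (nbhd G s(x, y) \ D).card ≤ 20) : s(x, y) ∈ A :=
  hA _ h hP D hc fun _ hd => Or.inl (hD hd)

lemma Closed.mem_of_full (hreg : ∀ v, G.degree v = 4) (hA : Closed G P ψ₀ A) {x y z : V}
    (hz : Full G A z) (hxz : G.Adj x z) (h : G.Adj x y) (hP : s(x, y) ∉ P) : s(x, y) ∈ A := by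
  by_cases hyz : y = z
  · subst hyz
    rw [Sym2.eq_swap]
    exact hz x h.symm
  refine hA.mem_of_card_le h hP _ hz.incidence_subset ?_
  obtain ⟨a, b, -, -, -, -, -, hx⟩ := exists_neighbors' hreg h hxz hyz
  obtain ⟨a', b', c', -, -, -, -, -, -, hy⟩ := exists_neighbors hreg h.symm
  have := card_nbhd_sdiff_le (G := G) (G.incidenceFinset z) (fun z => (hx z).1) (fun z => (hy z).1)
  have h4 := fun v => card_incidence_sdiff_le_four hreg v (G.incidenceFinset z)
  have := h4 a; have := h4 b; have := h4 a'; have := h4 b'; have := h4 c'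
  have : (G.incidenceFinset z \ G.incidenceFinset z).card = 0 := by simp
  omega

lemma Closed.mem_of_four (hreg : ∀ v, G.degree v = 4) (hA : Closed G P ψ₀ A) {x y : V}
    (h : G.Adj x y) (hP : s(x, y) ∉ P) (D : Finset (Sym2 V)) (hc : D.card = 4)
    (hDn : D ⊆ nbhd G s(x, y))
    (hD : ∀ d ∈ D, d ∈ A ∨ d ∈ P ∧ ∃ d' ∈ nbhd G s(x, y) \ D, d' ∈ P ∧ ψ₀ d' = ψ₀ d) :
    s(x, y) ∈ A := by
  refine hA _ h hP D ?_ hD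
  have h1 := card_nbhd_le hreg h
  have h2 := Finset.card_sdiff_add_card_eq_card hDn
  omega

lemma Closed.full_of_connected (hreg : ∀ v, G.degree v = 4) (hA : Closed G ∅ ψ₀ A)
    (hG : G.Connected) {z : V} (hz : Full G A z) (x : V) : Full G A x := by
  have h := (SimpleGraph.reachable_iff_reflTransGen z x).1 (hG.preconnected z x)
  induction h with
  | refl => exact hz
  | tail _ hbc ih => exact fun y hy => hA.mem_of_full hreg ih hbc.symm hy (by simp)

lemma Closed.triangle_mem (hreg : ∀ v, G.degree v = 4) (hA : Closed G ∅ ψ₀ A) {x y z : V}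
    (hxy : G.Adj x y) (hxz : G.Adj x z) (hyz : G.Adj y z) : s(x, y) ∈ A := by
  refine hA.mem_of_card_le hxy (by simp) ∅ (by simp) ?_
  obtain ⟨a, b, -, -, -, -, -, hx⟩ := exists_neighbors' hreg hxy hxz hyz.ne
  obtain ⟨a', b', -, -, -, -, -, hy⟩ := exists_neighbors' hreg hxy.symm hyz hxz.ne
  have := card_nbhd_sdiff_le (G := G) (G.incidenceFinset z) (fun z => (hx z).1) (fun z => (hy z).1)
  have h4 := fun v => card_incidence_sdiff_le_four hreg v (G.incidenceFinset z)
  have := h4 a; have := h4 b; have := h4 a'; have := h4 b'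
  have : (G.incidenceFinset z \ G.incidenceFinset z).card = 0 := by simp
  have h5 := Finset.le_card_sdiff (G.incidenceFinset z) (nbhd G s(x, y))
  rw [G.card_incidenceFinset_eq_degree, hreg] at h5
  simp only [Finset.sdiff_empty]
  omega

theorem exists_validOn_of_triangle (hreg : ∀ v, G.degree v = 4) (hG : G.Connected) {x y z : V}
    (hxy : G.Adj x y) (hxz : G.Adj x z) (hyz : G.Adj y z) :
    ∃ ψ, ValidOn G G.edgeFinset ψ := by
  obtain ⟨ψ, hψ⟩ := exists_validOn_of_closed (G := G) ∅ ∅ (fun _ => 0) (by simp [ValidOn]) (by simp)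
    (fun A _ hA e he _ => by
      refine mem_of_forall_full (hA.full_of_connected hreg hG (z := x) ?_) e he
      have h1 := hA.triangle_mem hreg hxy hxz hyz
      have h2 := hA.triangle_mem hreg hxz hxy hyz.symm
      have h3 := hA.triangle_mem hreg hyz hxy.symm hxz.symm
      intro p hp
      by_cases hpy : p = y
      · rwa [hpy]
      by_cases hpz : p = z
      · rwa [hpz]
      refine hA.mem_of_card_le hp (by simp) {s(x, y), s(x, z), s(y, z)} (by grind) ?_
      have hx : ∃ p', ∀ w, G.Adj x w → w = p ∨ w = y ∨ w = z ∨ w = p' := by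
        obtain ⟨a, b, -, -, -, -, -, hx⟩ := exists_neighbors' hreg hxy hxz hyz.ne
        rcases (hx p).1 hp with h | h | rfl | rfl
        · exact absurd h hpy
        · exact absurd h hpz
        · exact ⟨b, fun w hw => by grind⟩
        · exact ⟨a, fun w hw => by grind⟩
      obtain ⟨p', hx⟩ := hx
      obtain ⟨a, b, c, -, -, -, -, -, -, hy⟩ := exists_neighbors hreg hp.symm
      have := card_nbhd_sdiff_le (G := G) {s(x, y), s(x, z), s(y, z)} hx (fun z => (hy z).1)
      have h4 := fun v => card_incidence_sdiff_le_four hreg v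
        ({s(x, y), s(x, z), s(y, z)} : Finset (Sym2 V))
      have := h4 a; have := h4 b; have := h4 c; have := h4 p'
      have h5 := card_incidence_sdiff_add_le hreg y {s(x, y), s(x, z), s(y, z)} {x, z}
        (by simp [hxy.symm, hyz])
      have h6 := card_incidence_sdiff_add_le hreg z {s(x, y), s(x, z), s(y, z)} {x, y}
        (by simp [hxz.symm, hyz.symm])
      rw [Finset.card_pair hxz.ne] at h5
      rw [Finset.card_pair hxy.ne] at h6
      omega)
  exact ⟨ψ, by simpa using hψ⟩

end StrongEdge

namespace StrongEdge

open Finset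

section ListColoring

variable {ι κ : Type*} [DecidableEq ι] [DecidableEq κ]

lemma exists_injOn_of_card_le_biUnion [Inhabited κ] (U : Finset ι) (L : ι → Finset κ)
    (h : ∀ S ⊆ U, S.card ≤ (S.biUnion L).card) :
    ∃ φ : ι → κ, (∀ i ∈ U, φ i ∈ L i) ∧ ∀ i ∈ U, ∀ j ∈ U, φ i = φ j → i = j := by
  have hall : ∀ s : Finset {i // i ∈ U}, s.card ≤ (s.biUnion fun i => L i).card := by
    intro s
    have h1 := h (s.image Subtype.val) (by intro i; simp; tauto)
    rwa [Finset.image_biUnion, Finset.card_image_of_injective _ Subtype.val_injective] at h1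
  obtain ⟨f, hf, hfL⟩ := (Finset.all_card_le_biUnion_card_iff_exists_injective _).1 hall
  refine ⟨fun i => if hi : i ∈ U then f ⟨i, hi⟩ else default, fun i hi => ?_,
    fun i hi j hj hij => ?_⟩
  · simpa [hi] using hfL ⟨i, hi⟩
  · simp only [hi, hj, dite_true] at hij
    simpa using hf hij

lemma card_le_of_pairs {R : Finset ι} {M : Finset (ι × ι)} {S : Finset ι}
    (hU : ∀ i ∈ S, i ∈ R ∨ ∃ p ∈ M, i = p.1 ∨ i = p.2) : S.card ≤ 2 * M.card + R.card := by
  have h1 : S ⊆ (M.image Prod.fst ∪ M.image Prod.snd) ∪ R := by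
    intro i hi
    rcases hU i hi with h | ⟨p, hp, h⟩ <;> simp only [mem_union, mem_image] <;> grind
  have h2 := Finset.card_le_card h1
  have h3 := Finset.card_union_le (M.image Prod.fst ∪ M.image Prod.snd) R
  have h4 := Finset.card_union_le (M.image Prod.fst) (M.image Prod.snd)
  have h5 := Finset.card_image_le (s := M) (f := Prod.fst)
  have h6 := Finset.card_image_le (s := M) (f := Prod.snd)
  omega

lemma card_le_of_no_pair {R : Finset ι} {M : Finset (ι × ι)} {S : Finset ι}
    (hU : ∀ i ∈ S, i ∈ R ∨ ∃ p ∈ M, i = p.1 ∨ i = p.2) (hS : ∀ p ∈ M, p.1 ∈ S → p.2 ∉ S) :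
    S.card ≤ M.card + (S ∩ R).card := by
  have h1 : (S \ R).card ≤ M.card := by
    have : ∀ i ∈ S \ R, ∃ p ∈ M, i = p.1 ∨ i = p.2 := by
      intro i hi
      rw [mem_sdiff] at hi
      exact (hU i hi.1).resolve_left hi.2
    choose! p hp hpi using this
    refine Finset.card_le_card_of_injOn p (fun i hi => hp i hi) fun i hi j hj hij => ?_
    have hi' := hpi i hi
    have hj' := hpi j hj
    have := hS (p i) (hp i hi)
    rw [mem_coe, mem_sdiff] at hi hj
    grind
  have h2 := Finset.card_sdiff_add_card_inter S R
  omega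

/-- List coloring of the vertices in `U`, all of which must receive distinct colors except that
the two ends of a pair in `M` may share a color. -/
theorem exists_list_coloring [Inhabited κ]
    (R : Finset ι) (M : Finset (ι × ι)) (U : Finset ι) (L : ι → Finset κ)
    (hU : ∀ i ∈ U, i ∈ R ∨ ∃ p ∈ M, i = p.1 ∨ i = p.2)
    (hM : ∀ p ∈ M, 2 * M.card + R.card ≤ (L p.1).card + (L p.2).card)
    (hS : ∀ S ⊆ U, S.Nonempty → (∀ p ∈ M, p.1 ∈ S → p.2 ∉ S) →
      M.card + (S ∩ R).card ≤ (S.biUnion L).card) :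
    ∃ φ : ι → κ, (∀ i ∈ U, φ i ∈ L i) ∧
      ∀ i ∈ U, ∀ j ∈ U, φ i = φ j → i = j ∨ (i, j) ∈ M ∨ (j, i) ∈ M := by
  by_cases hc : ∃ p ∈ M, ∃ c, c ∈ L p.1 ∧ c ∈ L p.2
  · obtain ⟨⟨a, b⟩, hp, c, hca, hcb⟩ := hc
    have hcard : (M.erase (a, b)).card + 1 = M.card := Finset.card_erase_add_one hp
    have herase : ∀ i, (L i).card ≤ ((L i).erase c).card + 1 := fun i => by
      have := Finset.pred_card_le_card_erase (s := L i) (a := c)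
      omega
    have key := exists_list_coloring R (M.erase (a, b)) ((U.erase a).erase b)
      (fun i => (L i).erase c) ?_ ?_ ?_
    · obtain ⟨φ, h1, h2⟩ := key
      refine ⟨fun i => if i = a ∨ i = b then c else φ i, fun i hi => ?_, fun i hi j hj hij => ?_⟩
      · by_cases h : i = a ∨ i = b
        · simp only [h, if_true]
          rcases h with rfl | rfl <;> assumption
        · simp only [h, if_false]
          exact Finset.mem_of_mem_erase (h1 i (by grind))
      · have hci : ∀ i ∈ U, ¬ (i = a ∨ i = b) → φ i ≠ c := fun i hi h =>
          Finset.ne_of_mem_erase (h1 i (by grind))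
        by_cases hi' : i = a ∨ i = b
        · by_cases hj' : j = a ∨ j = b
          · grind
          · simp only [hi', hj', if_true, if_false] at hij
            exact absurd hij.symm (hci j hj hj')
        · by_cases hj' : j = a ∨ j = b
          · simp only [hi', hj', if_true, if_false] at hij
            exact absurd hij (hci i hi hi')
          · simp only [hi', hj', if_false] at hij
            have := h2 i (by grind) j (by grind) hij
            grind
    · intro i hi
      rcases hU i (by grind) with h | ⟨p, hpM, h⟩
      · exact Or.inl h
      · exact Or.inr ⟨p, Finset.mem_erase.2 ⟨by grind, hpM⟩, h⟩
    · intro p hpM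
      have := hM p (Finset.mem_of_mem_erase hpM)
      have := herase p.1
      have := herase p.2
      omega
    · intro S hSU hne hSM
      have h3 := hS S (hSU.trans ((Finset.erase_subset _ _).trans (Finset.erase_subset _ _))) hne
        (fun p hpM h => by
          by_cases hpe : p = (a, b)
          · subst hpe
            have := hSU h
            grind
          · exact hSM p (Finset.mem_erase.2 ⟨hpe, hpM⟩) h)
      have h4 : (S.biUnion L).card ≤ (S.biUnion fun i => (L i).erase c).card + 1 := by
        have : (S.biUnion fun i => (L i).erase c) = (S.biUnion L).erase c := by
          ext x; simp only [mem_biUnion, mem_erase]; grind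
        rw [this]
        have := Finset.pred_card_le_card_erase (s := S.biUnion L) (a := c)
        omega
      omega
  · have key := exists_injOn_of_card_le_biUnion U L ?_
    · obtain ⟨φ, h1, h2⟩ := key
      exact ⟨φ, h1, fun i hi j hj hij => Or.inl (h2 i hi j hj hij)⟩
    intro S hSU
    by_cases hp : ∀ p ∈ M, p.1 ∈ S → p.2 ∉ S
    · rcases S.eq_empty_or_nonempty with rfl | hne
      · simp
      exact (card_le_of_no_pair (fun i hi => hU i (hSU hi)) hp).trans (hS S hSU hne hp)
    · push Not at hp
      obtain ⟨p, hpM, hp1, hp2⟩ := hp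
      refine (card_le_of_pairs fun i hi => hU i (hSU hi)).trans ((hM p hpM).trans ?_)
      rw [← Finset.card_union_of_disjoint]
      · exact Finset.card_le_card (Finset.union_subset (Finset.subset_biUnion_of_mem L hp1)
          (Finset.subset_biUnion_of_mem L hp2))
      · rw [Finset.disjoint_left]
        exact fun x hx hx' => hc ⟨p, hpM, x, hx, hx'⟩
termination_by M.card
decreasing_by omega

end ListColoring

end StrongEdge

namespace StrongEdge

open Finset

lemma Full.mono {V : Type*} {G : SimpleGraph V} {A B : Finset (Sym2 V)} {z : V} (h : Full G A z)
    (hAB : A ⊆ B) : Full G B z :=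
  fun y hy => hAB (h y hy)

/-- The closed walk `x y z w` is a cycle of length four. -/
structure IsSquare {V : Type*} (G : SimpleGraph V) (x y z w : V) : Prop where
  xy : G.Adj x y
  yz : G.Adj y z
  zw : G.Adj z w
  wx : G.Adj w x
  xz : x ≠ z
  yw : y ≠ w

lemma IsSquare.reflect {V : Type*} {G : SimpleGraph V} {x y z w : V} (h : IsSquare G x y z w) :
    IsSquare G y x w z :=
  ⟨h.xy.symm, h.wx.symm, h.zw.symm, h.yz.symm, h.yw, h.xz⟩

lemma IsSquare.rotate {V : Type*} {G : SimpleGraph V} {x y z w : V} (h : IsSquare G x y z w) :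
    IsSquare G y z w x :=
  ⟨h.yz, h.zw, h.wx, h.xy, h.yw, h.xz.symm⟩

/-- Two vertices with a common neighbor are not adjacent. -/
def TriangleFree {V : Type*} (G : SimpleGraph V) : Prop :=
  ∀ a b c, G.Adj a b → G.Adj b c → ¬ G.Adj a c

variable {V : Type*} [Fintype V] [DecidableEq V] {G : SimpleGraph V} [DecidableRel G.Adj]
  {T : Finset (Sym2 V)} {x y z w : V}

/-- The number of common neighbors of two vertices. -/
def codegree (G : SimpleGraph V) [DecidableRel G.Adj] (x z : V) : ℕ :=
  (G.neighborFinset x ∩ G.neighborFinset z).card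

lemma codegree_comm (x z : V) : codegree G x z = codegree G z x := by
  rw [codegree, codegree, Finset.inter_comm]

lemma Full.card_eq_zero (h : Full G T x) : (G.incidenceFinset x \ T).card = 0 := by
  rw [Finset.card_eq_zero, Finset.sdiff_eq_empty_iff_subset]
  exact h.incidence_subset

lemma Full.card_incidence_le (hreg : ∀ v, G.degree v = 4) (h : Full G T x) {p : V}
    (hp : G.Adj x p) : (G.incidenceFinset p \ T).card ≤ 3 := by
  have := card_incidence_sdiff_add_le hreg p T {x}
    (by simpa [hp.symm, Sym2.eq_swap] using h p hp)
  rw [Finset.card_singleton] at this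
  omega

lemma Full.card_incidence_le_two (hreg : ∀ v, G.degree v = 4) (h : Full G T x) (h' : Full G T z)
    (hxz : x ≠ z) {p : V} (hp : G.Adj x p) (hp' : G.Adj z p) :
    (G.incidenceFinset p \ T).card ≤ 2 := by
  have := card_incidence_sdiff_add_le hreg p T {x, z}
    (by simpa [hp.symm, hp'.symm, Sym2.eq_swap] using ⟨h p hp, h' p hp'⟩)
  rw [Finset.card_pair hxz] at this
  omega

lemma exists_neighbor_four (hreg : ∀ v, G.degree v = 4) (hxy : G.Adj x y) (hxw : G.Adj x w)
    (hyw : y ≠ w) {p : V} (hp : G.Adj x p) (hpy : p ≠ y) (hpw : p ≠ w) :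
    ∃ q, G.Adj x q ∧ q ≠ p ∧ q ≠ y ∧ q ≠ w ∧
      ∀ u, G.Adj x u ↔ u = p ∨ u = y ∨ u = w ∨ u = q := by
  obtain ⟨a, b, h1, h2, h3, h4, h5, hx⟩ := exists_neighbors' hreg hxy hxw hyw
  rcases (hx p).1 hp with h | h | h | h
  · exact absurd h hpy
  · exact absurd h hpw
  · subst h; exact ⟨b, by grind⟩
  · subst h; exact ⟨a, by grind⟩

lemma card_nbhd_pendant_le (hreg : ∀ v, G.degree v = 4) (hx : Full G T x) (hy : Full G T y)
    (hw : Full G T w) (hxy : G.Adj x y) (hxw : G.Adj x w) (hyw : y ≠ w) {p : V}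
    (hp : G.Adj x p) (hpy : p ≠ y) (hpw : p ≠ w) : (nbhd G s(x, p) \ T).card ≤ 15 := by
  obtain ⟨q, hxq, -, -, -, hN⟩ := exists_neighbor_four hreg hxy hxw hyw hp hpy hpw
  obtain ⟨a, b, c, -, -, -, -, -, -, hp'⟩ := exists_neighbors hreg hp.symm
  have := card_nbhd_sdiff_le T (fun u => (hN u).1) (fun u => (hp' u).1)
  have h4 := fun v => card_incidence_sdiff_le_four hreg v T
  have := h4 a; have := h4 b; have := h4 c
  have := hx.card_incidence_le hreg hxq
  have := hy.card_eq_zero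
  have := hw.card_eq_zero
  omega

lemma card_nbhd_pendant_le' (hreg : ∀ v, G.degree v = 4) (hx : Full G T x) (hy : Full G T y)
    (hz : Full G T z) (hw : Full G T w) (hxy : G.Adj x y) (hxw : G.Adj x w) (hyw : y ≠ w)
    (hxz : x ≠ z) {p : V} (hp : G.Adj x p) (hpy : p ≠ y) (hpw : p ≠ w) (hpz : G.Adj p z) :
    (nbhd G s(x, p) \ T).card ≤ 11 := by
  obtain ⟨q, hxq, -, -, -, hN⟩ := exists_neighbor_four hreg hxy hxw hyw hp hpy hpw
  obtain ⟨a, b, -, -, -, -, -, hp'⟩ := exists_neighbors' hreg hp.symm hpz hxz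
  have := card_nbhd_sdiff_le T (fun u => (hN u).1) (fun u => (hp' u).1)
  have h4 := fun v => card_incidence_sdiff_le_four hreg v T
  have := h4 a; have := h4 b
  have := hx.card_incidence_le hreg hxq
  have := hy.card_eq_zero
  have := hw.card_eq_zero
  have := hz.card_eq_zero
  omega

lemma card_incidence_add_codegree_le (hreg : ∀ v, G.degree v = 4) (hx : Full G T x)
    (hz : Full G T z) (hxz : x ≠ z) {a b : V}
    (hN : ∀ u, G.Adj x u ↔ u = y ∨ u = w ∨ u = a ∨ u = b) :
    (G.incidenceFinset a \ T).card + (G.incidenceFinset b \ T).card + codegree G x z ≤ 8 := by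
  have ha : G.Adj x a := (hN a).2 (by simp)
  have hb : G.Adj x b := (hN b).2 (by simp)
  have h1 := hx.card_incidence_le hreg ha
  have h2 := hx.card_incidence_le hreg hb
  have key : ∀ s : Finset V, (∀ u, G.Adj x u → G.Adj z u → u ∈ s) → codegree G x z ≤ s.card :=
    fun s hs => Finset.card_le_card fun u hu => by
      simp only [mem_inter, SimpleGraph.mem_neighborFinset] at hu
      exact hs u hu.1 hu.2
  by_cases ha' : G.Adj z a <;> by_cases hb' : G.Adj z b
  · have := hx.card_incidence_le_two hreg hz hxz ha ha'
    have := hx.card_incidence_le_two hreg hz hxz hb hb'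
    have := key {y, w, a, b} (by grind)
    have := Finset.card_le_four (a := y) (b := w) (c := a) (d := b)
    omega
  · have := hx.card_incidence_le_two hreg hz hxz ha ha'
    have := key {y, w, a} (by grind)
    have := Finset.card_le_three (a := y) (b := w) (c := a)
    omega
  · have := hx.card_incidence_le_two hreg hz hxz hb hb'
    have := key {y, w, b} (by grind)
    have := Finset.card_le_three (a := y) (b := w) (c := b)
    omega
  · have := key {y, w} (by grind)
    have := Finset.card_le_two (a := y) (b := w)
    omega

lemma IsSquare.card_nbhd_le (hreg : ∀ v, G.degree v = 4) (hx : Full G T x) (hy : Full G T y)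
    (hz : Full G T z) (hw : Full G T w) (h : IsSquare G x y z w) :
    (nbhd G s(x, y) \ T).card + codegree G x z + codegree G y w ≤ 16 := by
  obtain ⟨a, b, -, -, -, -, -, hN⟩ := exists_neighbors' hreg h.xy h.wx.symm h.yw
  obtain ⟨a', b', -, -, -, -, -, hN'⟩ := exists_neighbors' hreg h.xy.symm h.yz h.xz
  have := card_nbhd_sdiff_le T (fun u => (hN u).1) (fun u => (hN' u).1)
  have := card_incidence_add_codegree_le hreg hx hz h.xz hN
  have := card_incidence_add_codegree_le hreg hy hw h.yw hN'
  have := hz.card_eq_zero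
  have := hw.card_eq_zero
  omega

/-- The colors available for `e` when the edges outside `U` are colored by `ψ`. -/
noncomputable def avail (G : SimpleGraph V) [DecidableRel G.Adj] (U : Finset (Sym2 V))
    (ψ : Sym2 V → Fin 21) (e : Sym2 V) : Finset (Fin 21) :=
  univ \ (nbhd G e \ U).image ψ

lemma le_card_avail (U : Finset (Sym2 V)) (ψ : Sym2 V → Fin 21) (e : Sym2 V) :
    21 ≤ (avail G U ψ e).card + (nbhd G e \ U).card := by
  have h1 := Finset.le_card_sdiff ((nbhd G e \ U).image ψ) (univ : Finset (Fin 21))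
  have h2 : ((nbhd G e \ U).image ψ).card ≤ _ := Finset.card_image_le
  rw [Finset.card_univ, Fintype.card_fin] at h1
  unfold avail
  omega

lemma exists_validOn_of_avail {U : Finset (Sym2 V)} {ψ φ : Sym2 V → Fin 21}
    (hψ : ValidOn G (G.edgeFinset \ U) ψ) (hφ : ValidOn G U φ) (h : ∀ e ∈ U, φ e ∈ avail G U ψ e) :
    ∃ ψ', ValidOn G G.edgeFinset ψ' := by
  have key : ∀ e ∈ U, ∀ f ∉ U, f ∈ nbhd G e → φ e ≠ ψ f := by
    intro e he f hf hef heq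
    have := h e he
    simp only [avail, mem_sdiff, mem_image, not_exists] at this
    exact this.2 f ⟨⟨hef, hf⟩, heq.symm⟩
  refine ⟨fun e => if e ∈ U then φ e else ψ e, fun e he f hf hef => ?_⟩
  by_cases h1 : e ∈ U <;> by_cases h2 : f ∈ U <;> simp only [h1, h2, if_true, if_false]
  · exact hφ e h1 f h2 hef
  · exact key e h1 f h2 hef
  · exact (key f h2 e h1 (mem_nbhd_comm (SimpleGraph.mem_edgeFinset.1 he) hef)).symm
  · exact hψ e (mem_sdiff.2 ⟨he, h1⟩) f (mem_sdiff.2 ⟨hf, h2⟩) hef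

/-- In a connected graph, all edges but those in a set containing all edges at some vertex can be
colored. -/
lemma exists_validOn_sdiff (hreg : ∀ v, G.degree v = 4) (hG : G.Connected) (hx : Full G T x) :
    ∃ ψ, ValidOn G (G.edgeFinset \ T) ψ :=
  exists_validOn_of_closed (G := G) ∅ T (fun _ => 0) (by simp [ValidOn]) (by simp)
    fun _ hTA hA e he _ => mem_of_forall_full (hA.full_of_connected hreg hG (hx.mono hTA)) e he

end StrongEdge

namespace StrongEdge

open Finset

/-- List coloring of at most twelve vertices: four vertices in `C` and at most eight others. -/
theorem exists_list_coloring_twelve {ι κ : Type*} [DecidableEq ι] [DecidableEq κ] [Inhabited κ]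
    (U C E : Finset ι) (M : Finset (ι × ι)) (L : ι → Finset κ) (k : ℕ)
    (hU : U.card ≤ 12) (hCU : C ⊆ U) (hC : C.card = 4) (hEU : E ⊆ U) (hEC : Disjoint E C)
    (hE : k ≤ E.card) (hM : ∀ p ∈ M, (p.1 ∈ U ∧ p.1 ∉ C ∧ p.1 ∉ E) ∧ p.2 ∈ U ∧ p.2 ∉ C ∧ p.2 ∉ E)
    (hM₁ : Set.InjOn Prod.fst (M : Set (ι × ι))) (hM₂ : Set.InjOn Prod.snd (M : Set (ι × ι)))
    (hM₁₂ : ∀ p ∈ M, ∀ q ∈ M, p.1 ≠ q.2)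
    (hLU : ∀ i ∈ U, 6 ≤ (L i).card) (hLC : ∀ i ∈ C, 9 + k ≤ (L i).card)
    (hLE : ∀ i ∈ E, 10 ≤ (L i).card) (hk : 2 ≤ M.card + k)
    (hk' : 3 ≤ M.card + k ∨ ∃ c ∈ C, ∃ c' ∈ C, 10 + k ≤ (L c ∪ L c').card) :
    ∃ φ : ι → κ, (∀ i ∈ U, φ i ∈ L i) ∧
      ∀ i ∈ U, ∀ j ∈ U, φ i = φ j → i = j ∨ (i, j) ∈ M ∨ (j, i) ∈ M := by
  set W := M.image Prod.fst ∪ M.image Prod.snd with hW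
  have hWcard : W.card = 2 * M.card := by
    rw [hW, Finset.card_union_of_disjoint, Finset.card_image_of_injOn hM₁,
      Finset.card_image_of_injOn hM₂, two_mul]
    rw [Finset.disjoint_left]
    intro i hi hi'
    simp only [mem_image] at hi hi'
    obtain ⟨p, hp, rfl⟩ := hi
    obtain ⟨q, hq, h⟩ := hi'
    exact hM₁₂ p hp q hq h.symm
  have hWm : ∀ i ∈ W, i ∈ U ∧ i ∉ C ∧ i ∉ E := by
    intro i hi
    simp only [hW, mem_union, mem_image] at hi
    rcases hi with ⟨p, hp, rfl⟩ | ⟨p, hp, rfl⟩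
    · exact (hM p hp).1
    · exact (hM p hp).2
  have hWU : W ⊆ U := fun i hi => (hWm i hi).1
  have hWC : Disjoint C W := Finset.disjoint_left.2 fun i hi hi' => (hWm i hi').2.1 hi
  have hUW := Finset.card_sdiff_add_card_eq_card hWU
  have hUWC : ((U \ W) \ C).card + C.card = (U \ W).card :=
    Finset.card_sdiff_add_card_eq_card (Finset.subset_sdiff.2 ⟨hCU, hWC⟩)
  have hUWCE : (((U \ W) \ C) \ E).card + E.card = ((U \ W) \ C).card :=
    Finset.card_sdiff_add_card_eq_card fun i hi => by
      simp only [mem_sdiff]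
      exact ⟨⟨hEU hi, fun h => (hWm i h).2.2 hi⟩, Finset.disjoint_left.1 hEC hi⟩
  refine exists_list_coloring (U \ W) M U L (fun i hi => ?_) (fun p hp => ?_)
    (fun S hSU hne _ => ?_)
  · by_cases h : i ∈ W
    · simp only [hW, mem_union, mem_image] at h
      grind
    · exact Or.inl (mem_sdiff.2 ⟨hi, h⟩)
  · have := hLU _ (hM p hp).1.1
    have := hLU _ (hM p hp).2.1
    omega
  have hle : ∀ i ∈ S, (L i).card ≤ (S.biUnion L).card := fun i hi =>
    Finset.card_le_card (Finset.subset_biUnion_of_mem L hi)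
  by_cases hSC : C ⊆ S
  · have hS : (S ∩ (U \ W)).card ≤ (U \ W).card := Finset.card_le_card Finset.inter_subset_right
    rcases hk' with hk' | ⟨c, hc, c', hc', hcc⟩
    · obtain ⟨c, hc⟩ := Finset.card_pos.1 (by omega : 0 < C.card)
      have := hLC c hc
      have := hle c (hSC hc)
      omega
    · have : (L c ∪ L c').card ≤ (S.biUnion L).card := Finset.card_le_card
        (Finset.union_subset (Finset.subset_biUnion_of_mem L (hSC hc))
          (Finset.subset_biUnion_of_mem L (hSC hc')))
      omega
  obtain ⟨c₀, hc₀, hc₀S⟩ := Finset.not_subset.1 hSC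
  by_cases hSC' : ∃ c ∈ C, c ∈ S
  · obtain ⟨c, hc, hcS⟩ := hSC'
    have h1 : (S ∩ (U \ W)).card ≤ ((U \ W).erase c₀).card := Finset.card_le_card fun i hi => by
      rw [mem_inter] at hi
      refine mem_erase.2 ⟨?_, hi.2⟩
      rintro rfl
      exact hc₀S hi.1
    rw [Finset.card_erase_of_mem (mem_sdiff.2 ⟨hCU hc₀, Finset.disjoint_left.1 hWC hc₀⟩)] at h1
    have := hLC c hc
    have := hle c hcS
    omega
  · push Not at hSC'
    have hsub : S ∩ (U \ W) ⊆ (U \ W) \ C := fun i hi => by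
      rw [mem_inter] at hi
      exact mem_sdiff.2 ⟨hi.2, fun h => hSC' i h hi.1⟩
    by_cases hSE : ∃ i ∈ E, i ∈ S
    · obtain ⟨i, hi, hiS⟩ := hSE
      have := Finset.card_le_card hsub
      have := hLE i hi
      have := hle i hiS
      omega
    · push Not at hSE
      have : S ∩ (U \ W) ⊆ ((U \ W) \ C) \ E := fun i hi =>
        mem_sdiff.2 ⟨hsub hi, fun h => hSE i h (mem_inter.1 hi).1⟩
      have := Finset.card_le_card this
      obtain ⟨i, hi⟩ := hne
      have := hLU i (hSU hi)
      have := hle i hi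
      omega

end StrongEdge

namespace StrongEdge

open Finset

variable {V : Type*} [Fintype V] [DecidableEq V] {G : SimpleGraph V} [DecidableRel G.Adj]
  {x y z w : V}

/-- The edges with an endpoint on the cycle `x y z w`. -/
def corona (G : SimpleGraph V) [DecidableRel G.Adj] (x y z w : V) : Finset (Sym2 V) :=
  G.incidenceFinset x ∪ G.incidenceFinset y ∪ G.incidenceFinset z ∪ G.incidenceFinset w

/-- The edges of the cycle `x y z w`. -/
def cycleEdges (x y z w : V) : Finset (Sym2 V) :=
  {s(x, y), s(y, z), s(z, w), s(w, x)}

/-- A matching `N` between neighbors of `x` and neighbors of `z`, such that matched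
neighbors `a`, `b` yield edges `s(x, a)` and `s(z, b)` that do not conflict. -/
def IsFreeMatching (G : SimpleGraph V) (x z : V) (N : Finset (V × V)) : Prop :=
  (∀ q ∈ N, G.Adj x q.1 ∧ G.Adj z q.2 ∧ ¬ G.Adj q.1 z ∧ ¬ G.Adj q.2 x ∧ ¬ G.Adj q.1 q.2) ∧
    Set.InjOn Prod.fst (N : Set (V × V)) ∧ Set.InjOn Prod.snd (N : Set (V × V))

lemma mem_corona {e : Sym2 V} :
    e ∈ corona G x y z w ↔ e ∈ G.edgeSet ∧ (x ∈ e ∨ y ∈ e ∨ z ∈ e ∨ w ∈ e) := by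
  simp only [corona, mem_union, mem_incidence]
  tauto

lemma full_corona :
    Full G (corona G x y z w) x ∧ Full G (corona G x y z w) y ∧ Full G (corona G x y z w) z ∧
      Full G (corona G x y z w) w := by
  refine ⟨?_, ?_, ?_, ?_⟩ <;> intro u hu <;> rw [mem_corona] <;> exact ⟨hu, by simp⟩

lemma IsSquare.card_corona_le (hreg : ∀ v, G.degree v = 4) (h : IsSquare G x y z w) :
    (corona G x y z w).card ≤ 12 := by
  have hT : Full G (G.incidenceFinset x ∪ G.incidenceFinset z) x := fun u hu =>
    mem_union_left _ (mem_incidence.2 ⟨hu, by simp⟩)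
  have hT' : Full G (G.incidenceFinset x ∪ G.incidenceFinset z) z := fun u hu =>
    mem_union_right _ (mem_incidence.2 ⟨hu, by simp⟩)
  have h1 := hT.card_incidence_le_two hreg hT' h.xz h.xy h.yz.symm
  have h2 := hT.card_incidence_le_two hreg hT' h.xz h.wx.symm h.zw
  have h3 : corona G x y z w ⊆ (G.incidenceFinset x ∪ G.incidenceFinset z) ∪
      ((G.incidenceFinset y \ (G.incidenceFinset x ∪ G.incidenceFinset z)) ∪
        (G.incidenceFinset w \ (G.incidenceFinset x ∪ G.incidenceFinset z))) := by
    intro e he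
    simp only [corona, mem_union, mem_sdiff] at he ⊢
    tauto
  have h4 := Finset.card_le_card h3
  have h5 := Finset.card_union_le (G.incidenceFinset x ∪ G.incidenceFinset z)
    ((G.incidenceFinset y \ (G.incidenceFinset x ∪ G.incidenceFinset z)) ∪
        (G.incidenceFinset w \ (G.incidenceFinset x ∪ G.incidenceFinset z)))
  have h6 := Finset.card_union_le
    (G.incidenceFinset y \ (G.incidenceFinset x ∪ G.incidenceFinset z))
    (G.incidenceFinset w \ (G.incidenceFinset x ∪ G.incidenceFinset z))
  have h7 := Finset.card_union_le (G.incidenceFinset x) (G.incidenceFinset z)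
  rw [G.card_incidenceFinset_eq_degree, G.card_incidenceFinset_eq_degree, hreg, hreg] at h7
  omega

lemma IsSquare.card_cycleEdges {V : Type*} [DecidableEq V] {G : SimpleGraph V} {x y z w : V}
    (h : IsSquare G x y z w) : (cycleEdges x y z w).card = 4 := by
  have := h.xy.ne; have := h.yz.ne; have := h.zw.ne; have := h.wx.ne
  have := h.xz; have := h.yw
  rw [cycleEdges, Finset.card_insert_of_notMem, Finset.card_insert_of_notMem, Finset.card_pair] <;>
    simp only [mem_insert, mem_singleton, ne_eq, Sym2.eq_iff] <;> grind

lemma IsSquare.cycleEdges_subset (h : IsSquare G x y z w) :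
    cycleEdges x y z w ⊆ corona G x y z w := by
  intro e he
  simp only [cycleEdges, mem_insert, mem_singleton] at he
  rw [mem_corona]
  rcases he with rfl | rfl | rfl | rfl
  · exact ⟨h.xy, by simp⟩
  · exact ⟨h.yz, by simp⟩
  · exact ⟨h.zw, by simp⟩
  · exact ⟨h.wx, by simp⟩

lemma IsSquare.card_nbhd_cycleEdges_le (hreg : ∀ v, G.degree v = 4) (h : IsSquare G x y z w)
    {c : Sym2 V} (hc : c ∈ cycleEdges x y z w) :
    (nbhd G c \ corona G x y z w).card + codegree G x z + codegree G y w ≤ 16 := by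
  obtain ⟨hx, hy, hz, hw⟩ := full_corona (G := G) (x := x) (y := y) (z := z) (w := w)
  simp only [cycleEdges, mem_insert, mem_singleton] at hc
  rcases hc with rfl | rfl | rfl | rfl
  · exact h.card_nbhd_le hreg hx hy hz hw
  · have := h.rotate.card_nbhd_le hreg hy hz hw hx
    rw [codegree_comm z x] at this
    omega
  · have := h.rotate.rotate.card_nbhd_le hreg hz hw hx hy
    rw [codegree_comm z x, codegree_comm w y] at this
    omega
  · have := h.rotate.rotate.rotate.card_nbhd_le hreg hw hx hy hz
    rw [codegree_comm w y] at this
    omega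

lemma IsSquare.card_nbhd_corona_le (hreg : ∀ v, G.degree v = 4) (h : IsSquare G x y z w)
    {e : Sym2 V} (he : e ∈ corona G x y z w) (hec : e ∉ cycleEdges x y z w) :
    (nbhd G e \ corona G x y z w).card ≤ 15 := by
  obtain ⟨hx, hy, hz, hw⟩ := full_corona (G := G) (x := x) (y := y) (z := z) (w := w)
  rw [mem_corona] at he
  simp only [cycleEdges, mem_insert, mem_singleton, not_or] at hec
  obtain ⟨heG, hv⟩ := he
  rcases hv with hv | hv | hv | hv <;> obtain ⟨p, rfl⟩ := Sym2.mem_iff_exists.1 hv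
  · exact card_nbhd_pendant_le hreg hx hy hw h.xy h.wx.symm h.yw heG (by grind) (by grind)
  · exact card_nbhd_pendant_le hreg hy hz hx h.yz h.xy.symm h.xz.symm heG (by grind) (by grind)
  · exact card_nbhd_pendant_le hreg hz hw hy h.zw h.yz.symm h.yw.symm heG (by grind) (by grind)
  · exact card_nbhd_pendant_le hreg hw hx hz h.wx h.zw.symm h.xz heG (by grind) (by grind)

lemma IsFreeMatching.ne {V : Type*} {G : SimpleGraph V} {x y z w : V} {N : Finset (V × V)}
    (hN : IsFreeMatching G x z N) (htf : TriangleFree G) (h : IsSquare G x y z w)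
    {q : V × V} (hq : q ∈ N) :
    (q.1 ≠ x ∧ q.1 ≠ y ∧ q.1 ≠ z ∧ q.1 ≠ w) ∧ (q.2 ≠ x ∧ q.2 ≠ y ∧ q.2 ≠ z ∧ q.2 ≠ w) := by
  obtain ⟨h1, h2, h3, h4, h5⟩ := hN.1 q hq
  have hxz := htf x y z h.xy h.yz
  refine ⟨⟨h1.ne.symm, ?_, ?_, ?_⟩, ⟨?_, ?_, h2.ne.symm, ?_⟩⟩ <;> intro heq
  · exact h3 (heq ▸ h.yz)
  · exact hxz (heq ▸ h1)
  · exact h3 (heq ▸ h.zw.symm)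
  · exact hxz (heq ▸ h2).symm
  · exact h4 (heq ▸ h.xy.symm)
  · exact h4 (heq ▸ h.wx)

lemma IsFreeMatching.not_mem_nbhd {N : Finset (V × V)} (hN : IsFreeMatching G x z N)
    (htf : TriangleFree G) (h : IsSquare G x y z w) {q : V × V} (hq : q ∈ N) :
    s(z, q.2) ∉ nbhd G s(x, q.1) ∧ s(x, q.1) ∉ nbhd G s(z, q.2) := by
  obtain ⟨⟨-, -, n3, -⟩, n1, -, -, -⟩ := hN.ne htf h hq
  obtain ⟨h1, h2, h3, h4, h5⟩ := hN.1 q hq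
  have hxz := htf x y z h.xy h.yz
  have hne := h.xz
  have h6 : q.1 ≠ q.2 := fun heq => h3 (heq ▸ h2.symm)
  have key : s(z, q.2) ∉ nbhd G s(x, q.1) := by
    rw [mem_nbhd_edges]
    rintro ⟨-, -, (h | h | h | h) | (h | h | h | h)⟩
    · exact hne h.symm
    · exact n3 h.symm
    · exact hxz h
    · exact h3 h
    · exact n1 h
    · exact h6 h.symm
    · exact h4 h.symm
    · exact h5 h
  exact ⟨key, fun hc => key (mem_nbhd_comm h2 hc)⟩

end StrongEdge

namespace StrongEdge

open Finset

variable {V : Type*} [Fintype V] [DecidableEq V] {G : SimpleGraph V} [DecidableRel G.Adj]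
  {x y z w : V}

lemma IsSquare.two_le_codegree (h : IsSquare G x y z w) : 2 ≤ codegree G x z := by
  rw [← Finset.card_pair h.yw, codegree]
  refine Finset.card_le_card fun u hu => ?_
  simp only [mem_insert, mem_singleton] at hu
  simp only [mem_inter, SimpleGraph.mem_neighborFinset]
  rcases hu with rfl | rfl
  · exact ⟨h.xy, h.yz.symm⟩
  · exact ⟨h.wx.symm, h.zw⟩

/-- The edges from `x` to the common neighbors of `x` and `z` other than `y` and `w`. -/
def chords (G : SimpleGraph V) [DecidableRel G.Adj] (x y z w : V) : Finset (Sym2 V) :=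
  ((G.neighborFinset x ∩ G.neighborFinset z) \ {y, w}).image fun p => s(x, p)

lemma mem_chords {e : Sym2 V} :
    e ∈ chords G x y z w ↔ ∃ p, G.Adj x p ∧ G.Adj z p ∧ p ≠ y ∧ p ≠ w ∧ e = s(x, p) := by
  simp only [chords, mem_image, mem_sdiff, mem_inter, SimpleGraph.mem_neighborFinset, mem_insert,
    mem_singleton, not_or]
  grind

lemma codegree_le_card_chords : codegree G x z ≤ (chords G x y z w).card + 2 := by
  rw [chords, Finset.card_image_of_injective _ fun a b h => by grind]
  have := Finset.le_card_sdiff {y, w} (G.neighborFinset x ∩ G.neighborFinset z)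
  have := Finset.card_le_two (a := y) (b := w)
  rw [codegree]
  omega

/-- The pairs of edges at `x` and `z` given by a matching `N`. -/
def edgePairs (x z : V) (N : Finset (V × V)) : Finset (Sym2 V × Sym2 V) :=
  N.image fun q => (s(x, q.1), s(z, q.2))

lemma mem_edgePairs {V : Type*} [DecidableEq V] {x z : V} {N : Finset (V × V)}
    {p : Sym2 V × Sym2 V} :
    p ∈ edgePairs x z N ↔ ∃ q ∈ N, p = (s(x, q.1), s(z, q.2)) := by
  simp only [edgePairs, mem_image]
  grind

lemma card_edgePairs {V : Type*} [DecidableEq V] {G : SimpleGraph V} {x z : V}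
    {N : Finset (V × V)} (hN : IsFreeMatching G x z N) : (edgePairs x z N).card = N.card := by
  refine Finset.card_image_of_injOn fun a ha b hb hab => hN.2.1 ha hb ?_
  simp only [Prod.mk.injEq] at hab
  grind

lemma injOn_edgePairs {V : Type*} [DecidableEq V] {G : SimpleGraph V} {x z : V}
    {N : Finset (V × V)} (hN : IsFreeMatching G x z N) :
    (∀ p ∈ edgePairs x z N, ∀ p' ∈ edgePairs x z N, p.1 = p'.1 → p = p') ∧
      ∀ p ∈ edgePairs x z N, ∀ p' ∈ edgePairs x z N, p.2 = p'.2 → p = p' := by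
  constructor <;> intro p hp p' hp' heq <;>
    obtain ⟨q, hq, rfl⟩ := mem_edgePairs.1 hp <;> obtain ⟨q', hq', rfl⟩ := mem_edgePairs.1 hp'
  · rw [hN.2.1 hq hq' (by grind)]
  · rw [hN.2.2 hq hq' (by grind)]

/-- Extending a coloring to the edges around a cycle of length four. -/
theorem IsSquare.exists_validOn (hreg : ∀ v, G.degree v = 4) (htf : TriangleFree G)
    (h : IsSquare G x y z w) {N N' : Finset (V × V)} (hN : IsFreeMatching G x z N)
    (hN' : IsFreeMatching G y w N') {ψ : Sym2 V → Fin 21}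
    (hψ : ValidOn G (G.edgeFinset \ corona G x y z w) ψ)
    (hk : 6 ≤ N.card + N'.card + codegree G x z + codegree G y w)
    (hk' : 7 ≤ N.card + N'.card + codegree G x z + codegree G y w ∨
      ∃ c ∈ cycleEdges x y z w, ∃ c' ∈ cycleEdges x y z w, 6 + codegree G x z + codegree G y w ≤
        (avail G (corona G x y z w) ψ c ∪ avail G (corona G x y z w) ψ c').card) :
    ∃ ψ', ValidOn G G.edgeFinset ψ' := by
  obtain ⟨hx, hy, hz, hw⟩ := full_corona (G := G) (x := x) (y := y) (z := z) (w := w)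
  have h2 := h.two_le_codegree
  have h2' := h.reflect.two_le_codegree
  have hxz := htf x y z h.xy h.yz
  have hyw := htf y z w h.yz h.zw
  have hne := h.xz
  have hne' := h.yw
  have hnxy := h.xy.ne
  have hnyz := h.yz.ne
  have hnzw := h.zw.ne
  have hnwx := h.wx.ne
  have hNne := fun q hq => hN.ne htf h (q := q) hq
  have hNne' := fun q hq => hN'.ne htf h.reflect (q := q) hq
  have hdisj : ∀ p ∈ edgePairs x z N, ∀ p' ∈ edgePairs y w N',
      p.1 ≠ p'.1 ∧ p.2 ≠ p'.2 ∧ p.1 ≠ p'.2 ∧ p'.1 ≠ p.2 := by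
    intro p hp p' hp'
    obtain ⟨q, hq, rfl⟩ := mem_edgePairs.1 hp
    obtain ⟨q', hq', rfl⟩ := mem_edgePairs.1 hp'
    have := hNne q hq
    have := hNne' q' hq'
    simp only [ne_eq, Sym2.eq_iff]
    grind
  have hcardM : (edgePairs x z N ∪ edgePairs y w N').card = N.card + N'.card := by
    rw [Finset.card_union_of_disjoint, card_edgePairs hN, card_edgePairs hN']
    exact Finset.disjoint_left.2 fun p hp hp' => (hdisj p hp p hp').1 rfl
  have hcardE : codegree G x z + codegree G y w ≤
      (chords G x y z w ∪ chords G y x w z).card + 4 := by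
    rw [Finset.card_union_of_disjoint]
    · have := codegree_le_card_chords (G := G) (x := x) (y := y) (z := z) (w := w)
      have := codegree_le_card_chords (G := G) (x := y) (y := x) (z := w) (w := z)
      omega
    · rw [Finset.disjoint_left]
      intro e he he'
      rw [mem_chords] at he he'
      grind
  obtain ⟨φ, hφ, hφ'⟩ := exists_list_coloring_twelve (corona G x y z w) (cycleEdges x y z w)
    (chords G x y z w ∪ chords G y x w z) (edgePairs x z N ∪ edgePairs y w N')
    (avail G (corona G x y z w) ψ) (codegree G x z + codegree G y w - 4)
    (h.card_corona_le hreg) h.cycleEdges_subset h.card_cycleEdges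
    (by
      intro e he
      rw [mem_union, mem_chords, mem_chords] at he
      rw [mem_corona]
      rcases he with ⟨p, h3, h4, h5, h6, rfl⟩ | ⟨p, h3, h4, h5, h6, rfl⟩ <;>
        exact ⟨h3, by simp⟩)
    (by
      rw [Finset.disjoint_left]
      intro e he he'
      rw [mem_union, mem_chords, mem_chords] at he
      simp only [cycleEdges, mem_insert, mem_singleton] at he'
      clear hk hk' hNne hNne' hdisj hcardM hcardE hN hN' hψ
      rcases he with ⟨p, h3, h4, h5, h6, rfl⟩ | ⟨p, h3, h4, h5, h6, rfl⟩ <;>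
        simp only [Sym2.eq_iff] at he' <;> grind)
    (by omega)
    (by
      intro p hp
      rw [mem_union, mem_edgePairs, mem_edgePairs] at hp
      simp only [cycleEdges, mem_insert, mem_singleton, mem_union, mem_chords, mem_corona]
      clear hk hk' hdisj hcardM hcardE hψ
      rcases hp with ⟨q, hq, rfl⟩ | ⟨q, hq, rfl⟩
      · obtain ⟨h3, h4, h5, h6, -⟩ := hN.1 q hq
        have h7 := hNne q hq
        clear hN hN' hNne hNne' hq
        have h8 : ∀ p, G.Adj z p → p ≠ q.1 := fun p hp heq => h5 (heq ▸ hp.symm)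
        have h9 : ∀ p, G.Adj x p → p ≠ q.2 := fun p hp heq => h6 (heq ▸ hp.symm)
        refine ⟨⟨⟨h3, by simp⟩, ?_, ?_⟩, ⟨h4, by simp⟩, ?_, ?_⟩ <;>
          simp only [Sym2.eq_iff] <;> grind
      · obtain ⟨h3, h4, h5, h6, -⟩ := hN'.1 q hq
        have h7 := hNne' q hq
        clear hN hN' hNne hNne' hq
        have h8 : ∀ p, G.Adj w p → p ≠ q.1 := fun p hp heq => h5 (heq ▸ hp.symm)
        have h9 : ∀ p, G.Adj y p → p ≠ q.2 := fun p hp heq => h6 (heq ▸ hp.symm)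
        refine ⟨⟨⟨h3, by simp⟩, ?_, ?_⟩, ⟨h4, by simp⟩, ?_, ?_⟩ <;>
          simp only [Sym2.eq_iff] <;> grind)
    (by
      intro p hp p' hp' heq
      rw [mem_coe, mem_union] at hp hp'
      rcases hp with hp | hp <;> rcases hp' with hp' | hp'
      · exact (injOn_edgePairs hN).1 p hp p' hp' heq
      · exact absurd heq (hdisj p hp p' hp').1
      · exact absurd heq.symm (hdisj p' hp' p hp).1
      · exact (injOn_edgePairs hN').1 p hp p' hp' heq)
    (by
      intro p hp p' hp' heq
      rw [mem_coe, mem_union] at hp hp'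
      rcases hp with hp | hp <;> rcases hp' with hp' | hp'
      · exact (injOn_edgePairs hN).2 p hp p' hp' heq
      · exact absurd heq (hdisj p hp p' hp').2.1
      · exact absurd heq.symm (hdisj p' hp' p hp).2.1
      · exact (injOn_edgePairs hN').2 p hp p' hp' heq)
    (by
      intro p hp p' hp'
      rw [mem_union] at hp hp'
      rcases hp with hp | hp <;> rcases hp' with hp' | hp'
      · obtain ⟨q, hq, rfl⟩ := mem_edgePairs.1 hp
        obtain ⟨q', hq', rfl⟩ := mem_edgePairs.1 hp'
        have := hNne q hq
        grind
      · exact (hdisj p hp p' hp').2.2.1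
      · exact (hdisj p' hp' p hp).2.2.2
      · obtain ⟨q, hq, rfl⟩ := mem_edgePairs.1 hp
        obtain ⟨q', hq', rfl⟩ := mem_edgePairs.1 hp'
        have := hNne' q hq
        grind)
    (by
      intro e he
      have := le_card_avail (G := G) (corona G x y z w) ψ e
      by_cases hec : e ∈ cycleEdges x y z w
      · have := h.card_nbhd_cycleEdges_le hreg hec
        omega
      · have := h.card_nbhd_corona_le hreg he hec
        omega)
    (by
      intro e he
      have := le_card_avail (G := G) (corona G x y z w) ψ e
      have := h.card_nbhd_cycleEdges_le hreg he
      omega)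
    (by
      intro e he
      have := le_card_avail (G := G) (corona G x y z w) ψ e
      rw [mem_union, mem_chords, mem_chords] at he
      rcases he with ⟨p, h3, h4, h5, h6, rfl⟩ | ⟨p, h3, h4, h5, h6, rfl⟩
      · have := card_nbhd_pendant_le' hreg hx hy hz hw h.xy h.wx.symm h.yw h.xz h3 h5 h6 h4.symm
        omega
      · have := card_nbhd_pendant_le' hreg hy hx hw hz h.xy.symm h.yz h.xz h.yw h3 h5 h6 h4.symm
        omega)
    (by omega)
    (by
      rcases hk' with hk' | ⟨c, hc, c', hc', hcc⟩
      · left; omega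
      · exact Or.inr ⟨c, hc, c', hc', by omega⟩)
  refine exists_validOn_of_avail hψ (φ := φ) (fun e he f hf hef heq => ?_) hφ
  have hMn : ∀ p ∈ edgePairs x z N ∪ edgePairs y w N', p.2 ∉ nbhd G p.1 ∧ p.1 ∉ nbhd G p.2 := by
    intro p hp
    rw [mem_union, mem_edgePairs, mem_edgePairs] at hp
    rcases hp with ⟨q, hq, rfl⟩ | ⟨q, hq, rfl⟩
    · exact hN.not_mem_nbhd htf h hq
    · exact hN'.not_mem_nbhd htf h.reflect hq
  rcases hφ' e he f hf heq with rfl | hp | hp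
  · exact (mem_nbhd.1 hef).2.1 rfl
  · exact (hMn _ hp).1 hef
  · exact (hMn _ hp).2 hef

end StrongEdge

namespace StrongEdge

open Finset

variable {V : Type*} [Fintype V] [DecidableEq V] {G : SimpleGraph V} [DecidableRel G.Adj]
  {x y z w : V}

lemma avail_update_of_mem {U : Finset (Sym2 V)} {ψ : Sym2 V → Fin 21} {g c : Sym2 V} {κ : Fin 21}
    (hg : g ∉ U) (hgc : g ∈ nbhd G c) :
    avail G U (Function.update ψ g κ) c = (avail G (insert g U) ψ c).erase κ := by
  ext κ'
  simp only [avail, mem_sdiff, mem_univ, true_and, mem_image, mem_erase, mem_insert, not_exists,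
    not_and, not_or, and_imp]
  constructor
  · intro h
    refine ⟨fun heq => h g hgc hg (by simp [heq]), fun f hf hfg hfU => ?_⟩
    simpa [Function.update_of_ne hfg] using h f hf hfU
  · rintro ⟨h1, h2⟩ f hf hfU
    by_cases hfg : f = g
    · subst hfg
      simpa using Ne.symm h1
    · rw [Function.update_of_ne hfg]
      exact h2 f hf hfg hfU

lemma avail_update_of_not_mem {U : Finset (Sym2 V)} {ψ : Sym2 V → Fin 21} {g c : Sym2 V}
    {κ : Fin 21} (hgc : g ∉ nbhd G c) :
    avail G U (Function.update ψ g κ) c = avail G U ψ c := by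
  unfold avail
  rw [Finset.image_congr]
  intro f hf
  rw [Function.update_of_ne]
  rintro rfl
  exact hgc (mem_sdiff.1 hf).1

/-- An edge `g` near one edge of the cycle but not near another can be recolored so that the
lists of these two edges differ. -/
lemma IsSquare.exists_validOn_sdiff_corona (hreg : ∀ v, G.degree v = 4) (hG : G.Connected)
    (h : IsSquare G x y z w) {g c c' : Sym2 V} (hgU : g ∉ corona G x y z w)
    (hcard : (nbhd G g \ corona G x y z w).card ≤ 19) (hc : c ∈ cycleEdges x y z w)
    (hc' : c' ∈ cycleEdges x y z w) (hgc : g ∈ nbhd G c) (hgc' : g ∉ nbhd G c') :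
    ∃ ψ, ValidOn G (G.edgeFinset \ corona G x y z w) ψ ∧ 6 + codegree G x z + codegree G y w ≤
      (avail G (corona G x y z w) ψ c ∪ avail G (corona G x y z w) ψ c').card := by
  obtain ⟨hx, -, -, -⟩ := full_corona (G := G) (x := x) (y := y) (z := z) (w := w)
  have hc1 := h.card_nbhd_cycleEdges_le hreg hc
  have hc2 := h.card_nbhd_cycleEdges_le hreg hc'
  set U := corona G x y z w
  obtain ⟨ψ, hψ⟩ := exists_validOn_sdiff hreg hG (hx.mono (Finset.subset_insert g U))
  set S := (nbhd G g \ U).image ψ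
  have hS : S.card ≤ 19 := Finset.card_image_le.trans hcard
  obtain ⟨κ, hκ⟩ := exists_color (S := S) (by omega)
  obtain ⟨κ', hκ'⟩ := exists_color (S := insert κ S)
    ((Finset.card_insert_le _ _).trans (by omega))
  rw [mem_insert, not_or] at hκ'
  have hvalid : ∀ κ ∉ S, ValidOn G (G.edgeFinset \ U) (Function.update ψ g κ) := by
    intro κ hκ
    refine validOn_update (fun f hf => SimpleGraph.mem_edgeFinset.1 (mem_sdiff.1 hf).1) ?_ ?_
    · rwa [← Finset.sdiff_insert]
    · intro f hf hfB hfκ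
      exact hκ (mem_image.2 ⟨f, mem_sdiff.2 ⟨hf, (mem_sdiff.1 hfB).2⟩, hfκ⟩)
  have h1 : (nbhd G c \ insert g U).card + 1 = (nbhd G c \ U).card := by
    rw [Finset.sdiff_insert, Finset.card_erase_add_one (mem_sdiff.2 ⟨hgc, hgU⟩)]
  have h2 := le_card_avail (G := G) (insert g U) ψ c
  have h3 := le_card_avail (G := G) U ψ c'
  by_contra! hcon
  have hsub : ∀ κ ∉ S, (avail G (insert g U) ψ c).erase κ ⊆ avail G U ψ c' := by
    intro κ hκ
    have h4 := hcon _ (hvalid κ hκ)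
    rw [avail_update_of_mem hgU hgc, avail_update_of_not_mem hgc', union_comm] at h4
    exact Finset.union_eq_left.1 (Finset.eq_of_subset_of_card_le Finset.subset_union_left
      (by omega)).symm
  have h5 : avail G (insert g U) ψ c ⊆ avail G U ψ c' := by
    intro a ha
    by_cases hak : a = κ
    · exact hsub κ' hκ'.2 (mem_erase.2 ⟨hak ▸ Ne.symm hκ'.1, ha⟩)
    · exact hsub κ hκ (mem_erase.2 ⟨hak, ha⟩)
  have h6 := hcon _ (hvalid κ hκ)
  rw [avail_update_of_mem hgU hgc, avail_update_of_not_mem hgc'] at h6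
  have h7 := Finset.card_le_card h5
  have h8 := Finset.card_le_card (Finset.subset_union_right
    (s₁ := (avail G (insert g U) ψ c).erase κ) (s₂ := avail G U ψ c'))
  omega

end StrongEdge

namespace StrongEdge

open Finset

variable {V : Type*} [Fintype V] [DecidableEq V] {G : SimpleGraph V} [DecidableRel G.Adj]
  {x y z w : V}

lemma IsSquare.exists_validOn_sdiff_corona_of_adj (hreg : ∀ v, G.degree v = 4) (hG : G.Connected)
    (htf : TriangleFree G) (h : IsSquare G x y z w) {p q u : V} (hxp : G.Adj x p)
    (hpz : ¬ G.Adj p z) (hzq : G.Adj z q) (hpq : G.Adj p q) (hpu : G.Adj p u)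
    (hux : u ≠ x) (huz : ¬ G.Adj u z) (huyw : ¬ (G.Adj u y ∧ G.Adj u w)) :
    ∃ ψ, ValidOn G (G.edgeFinset \ corona G x y z w) ψ ∧
      ∃ c ∈ cycleEdges x y z w, ∃ c' ∈ cycleEdges x y z w, 6 + codegree G x z + codegree G y w ≤
        (avail G (corona G x y z w) ψ c ∪ avail G (corona G x y z w) ψ c').card := by
  have hxz := htf x y z h.xy h.yz
  have hpy : p ≠ y := by rintro rfl; exact hpz h.yz
  have hpw : p ≠ w := by rintro rfl; exact hpz h.zw.symm
  have hpz' : p ≠ z := by rintro rfl; exact hxz hxp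
  have huy : u ≠ y := by rintro rfl; exact huz h.yz
  have huw : u ≠ w := by rintro rfl; exact huz h.zw.symm
  have huz' : u ≠ z := by rintro rfl; exact hpz hpu
  have hqu : q ≠ u := by rintro rfl; exact huz hzq.symm
  have hqx : q ≠ x := by rintro rfl; exact hxz hzq.symm
  have hpy' : ¬ G.Adj p y := htf p x y hxp.symm h.xy
  have hpw' : ¬ G.Adj p w := htf p x w hxp.symm h.wx.symm
  obtain ⟨hx, -, hz, -⟩ := full_corona (G := G) (x := x) (y := y) (z := z) (w := w)
  have hgU : s(p, u) ∉ corona G x y z w := by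
    rw [mem_corona]
    simp only [Sym2.mem_iff]
    have := hxp.ne
    grind
  have hcard : (nbhd G s(p, u) \ corona G x y z w).card ≤ 19 := by
    obtain ⟨a, b, -, -, -, -, -, hN⟩ := exists_neighbors' hreg hpu hxp.symm hux
    obtain ⟨a', b', c', -, -, -, -, -, -, hN'⟩ := exists_neighbors hreg hpu.symm
    have h1 := card_nbhd_sdiff_le (corona G x y z w) (fun v => (hN v).1) (fun v => (hN' v).1)
    have h2 := hx.card_eq_zero
    have h3 := hz.card_incidence_le hreg hzq
    have h4 := fun v => card_incidence_sdiff_le_four hreg v (corona G x y z w)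
    have := h4 a; have := h4 b; have := h4 a'; have := h4 b'; have := h4 c'
    rcases (hN q).1 hpq with rfl | rfl | rfl | rfl
    · exact absurd rfl hqu
    · exact absurd rfl hqx
    · omega
    · omega
  have hc : s(p, u) ∈ nbhd G s(x, y) :=
    mem_nbhd_edges.2 ⟨hpu, by simp only [ne_eq, Sym2.eq_iff]; grind, by tauto⟩
  have key : ∃ c' ∈ cycleEdges x y z w, s(p, u) ∉ nbhd G c' := by
    by_cases huy' : G.Adj u y
    · have huw' : ¬ G.Adj u w := fun hc => huyw ⟨huy', hc⟩
      refine ⟨s(z, w), by simp [cycleEdges], ?_⟩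
      rw [mem_nbhd_edges]
      rintro ⟨-, -, (h | h | h | h) | (h | h | h | h)⟩
      · exact hpz' h
      · exact hpw h
      · exact hpz h.symm
      · exact hpw' h.symm
      · exact huz' h
      · exact huw h
      · exact huz h.symm
      · exact huw' h.symm
    · refine ⟨s(y, z), by simp [cycleEdges], ?_⟩
      rw [mem_nbhd_edges]
      rintro ⟨-, -, (h | h | h | h) | (h | h | h | h)⟩
      · exact hpy h
      · exact hpz' h
      · exact hpy' h.symm
      · exact hpz h.symm
      · exact huy h
      · exact huz' h
      · exact huy' h.symm
      · exact huz h.symm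
  obtain ⟨c', hc', hgc'⟩ := key
  obtain ⟨ψ, h1, h2⟩ := h.exists_validOn_sdiff_corona hreg hG hgU hcard
    (by simp [cycleEdges] : s(x, y) ∈ cycleEdges x y z w) hc' hc hgc'
  exact ⟨ψ, h1, _, by simp [cycleEdges], c', hc', h2⟩

/-- The matchings and common neighbors at `x` and `z` save `k` colors. -/
def Credit (G : SimpleGraph V) [DecidableRel G.Adj] (x z : V) (k : ℕ) : Prop :=
  ∃ N, IsFreeMatching G x z N ∧ k + 2 ≤ N.card + codegree G x z

lemma IsSquare.exists_validOn_of_credit (hreg : ∀ v, G.degree v = 4) (hG : G.Connected)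
    (htf : TriangleFree G) (h : IsSquare G x y z w) (h1 : Credit G x z 2) (h2 : Credit G y w 1) :
    ∃ ψ, ValidOn G G.edgeFinset ψ := by
  obtain ⟨N, hN, hc⟩ := h1
  obtain ⟨N', hN', hc'⟩ := h2
  obtain ⟨ψ, hψ⟩ := exists_validOn_sdiff hreg hG
    (full_corona (G := G) (x := x) (y := y) (z := z) (w := w)).1
  exact h.exists_validOn hreg htf hN hN' hψ (by omega) (by omega)

lemma IsSquare.exists_validOn_of_adj (hreg : ∀ v, G.degree v = 4) (hG : G.Connected)
    (htf : TriangleFree G) (h : IsSquare G x y z w) (h1 : Credit G x z 1) (h2 : Credit G y w 1)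
    {p q u : V} (hxp : G.Adj x p) (hpz : ¬ G.Adj p z) (hzq : G.Adj z q)
    (hpq : G.Adj p q) (hpu : G.Adj p u) (hux : u ≠ x) (huz : ¬ G.Adj u z)
    (huyw : ¬ (G.Adj u y ∧ G.Adj u w)) : ∃ ψ, ValidOn G G.edgeFinset ψ := by
  obtain ⟨N, hN, hc⟩ := h1
  obtain ⟨N', hN', hc'⟩ := h2
  obtain ⟨ψ, hψ, hk⟩ := h.exists_validOn_sdiff_corona_of_adj hreg hG htf hxp hpz hzq hpq hpu hux huz
    huyw
  exact h.exists_validOn hreg htf hN hN' hψ (by omega) (Or.inr hk)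

end StrongEdge

namespace StrongEdge

open Finset

variable {V : Type*} [Fintype V] [DecidableEq V] {G : SimpleGraph V} [DecidableRel G.Adj]
  {x y z w : V}

lemma card_le_codegree {S : Finset V} (hS : ∀ u ∈ S, G.Adj u x ∧ G.Adj u z) :
    S.card ≤ codegree G x z := by
  refine Finset.card_le_card fun u hu => ?_
  simp only [mem_inter, SimpleGraph.mem_neighborFinset]
  exact ⟨(hS u hu).1.symm, (hS u hu).2.symm⟩

lemma three_le_codegree {a b c : V} (hab : a ≠ b) (hac : a ≠ c) (hbc : b ≠ c) (ha : G.Adj a x)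
    (ha' : G.Adj a z) (hb : G.Adj b x) (hb' : G.Adj b z) (hc : G.Adj c x) (hc' : G.Adj c z) :
    3 ≤ codegree G x z := by
  rw [← Finset.card_eq_three.2 ⟨a, b, c, hab, hac, hbc, rfl⟩]
  exact card_le_codegree (by simp [*])

lemma IsSquare.three_le_codegree (h : IsSquare G x y z w) {t : V} (hy : t ≠ y) (hw : t ≠ w)
    (hx : G.Adj t x) (hz : G.Adj t z) : 3 ≤ codegree G x z :=
  StrongEdge.three_le_codegree h.yw hy.symm hw.symm h.xy.symm h.yz h.wx h.zw.symm hx hz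

lemma IsSquare.four_le_codegree (h : IsSquare G x y z w) {t u : V} (hty : t ≠ y) (htw : t ≠ w)
    (hx : G.Adj t x) (hz : G.Adj t z) (huy : u ≠ y) (huw : u ≠ w)
    (hux : G.Adj u x) (huz : G.Adj u z) (htu : t ≠ u) : 4 ≤ codegree G x z := by
  have : ({y, w, t, u} : Finset V).card = 4 := by
    have := h.yw
    rw [Finset.card_insert_of_notMem, Finset.card_insert_of_notMem, Finset.card_pair htu] <;>
      simp only [mem_insert, mem_singleton] <;> grind
  rw [← this]
  exact card_le_codegree (by simp [h.xy.symm, h.yz, h.wx, h.zw.symm, *])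

lemma IsSquare.exists_of_three_le_codegree (h : 3 ≤ codegree G x z) :
    ∃ t, t ≠ y ∧ t ≠ w ∧ G.Adj t x ∧ G.Adj t z := by
  by_contra! hc
  have h1 : G.neighborFinset x ∩ G.neighborFinset z ⊆ {y, w} := by
    intro t ht
    simp only [mem_inter, SimpleGraph.mem_neighborFinset] at ht
    rw [mem_insert, mem_singleton]
    by_contra! h2
    exact hc t h2.1 h2.2 ht.1.symm ht.2.symm
  have h2 := Finset.card_le_card h1
  have := Finset.card_le_two (a := y) (b := w)
  rw [codegree] at h
  omega

lemma IsSquare.exists_of_not_credit_two (hreg : ∀ v, G.degree v = 4) (h : IsSquare G x y z w)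
    (hc : ¬ Credit G x z 2) : codegree G x z ≤ 3 ∧
      ∃ p q, G.Adj x p ∧ ¬ G.Adj p z ∧ G.Adj z q ∧ ¬ G.Adj q x ∧ G.Adj p q := by
  have h3 : codegree G x z ≤ 3 := by
    by_contra! h4
    exact hc ⟨∅, by simp [IsFreeMatching], by rw [card_empty]; omega⟩
  refine ⟨h3, ?_⟩
  by_contra! hno
  obtain ⟨a, b, ha1, hb1, ha2, hb2, hab, hN⟩ := exists_neighbors' hreg h.xy h.wx.symm h.yw
  obtain ⟨a', b', ha1', hb1', ha2', hb2', hab', hN'⟩ := exists_neighbors' hreg h.yz.symm h.zw h.yw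
  have hxa : G.Adj x a := (hN a).2 (by simp)
  have hxb : G.Adj x b := (hN b).2 (by simp)
  have hza : G.Adj z a' := (hN' a').2 (by simp)
  have hzb : G.Adj z b' := (hN' b').2 (by simp)
  rcases Nat.lt_or_ge (codegree G x z) 3 with h2 | h2
  · have h5 : ∀ t, t ≠ y → t ≠ w → G.Adj t x → ¬ G.Adj t z := fun t h6 h7 h8 h9 => by
      have := h.three_le_codegree h6 h7 h8 h9
      omega
    have h6 := h5 a ha1 ha2 hxa.symm
    have h7 := h5 b hb1 hb2 hxb.symm
    have h8 : ¬ G.Adj a' x := fun hc => h5 a' ha1' ha2' hc hza.symm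
    have h9 : ¬ G.Adj b' x := fun hc => h5 b' hb1' hb2' hc hzb.symm
    refine hc ⟨{(a, a'), (b, b')}, ⟨?_, ?_, ?_⟩, ?_⟩
    · intro q hq
      rw [mem_insert, mem_singleton] at hq
      rcases hq with rfl | rfl
      · exact ⟨hxa, hza, h6, h8, hno a a' hxa h6 hza h8⟩
      · exact ⟨hxb, hzb, h7, h9, hno b b' hxb h7 hzb h9⟩
    · intro q hq q' hq' heq
      rw [mem_coe, mem_insert, mem_singleton] at hq hq'
      grind
    · intro q hq q' hq' heq
      rw [mem_coe, mem_insert, mem_singleton] at hq hq'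
      grind
    · have := h.two_le_codegree
      rw [Finset.card_pair (by simp [hab])]
      omega
  · have h4 : ∀ t u, t ≠ y → t ≠ w → u ≠ y → u ≠ w → t ≠ u → G.Adj t x → G.Adj t z →
        G.Adj u x → ¬ G.Adj u z := fun t u h6 h7 h8 h9 h10 h11 h12 h13 h14 => by
      have := h.four_le_codegree h6 h7 h11 h12 h8 h9 h13 h14 h10
      omega
    have h5 : ∃ p, G.Adj x p ∧ ¬ G.Adj p z := by
      by_contra! h5
      exact h4 a b ha1 ha2 hb1 hb2 hab hxa.symm (h5 a hxa) hxb.symm (h5 b hxb)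
    have h6 : ∃ q, G.Adj z q ∧ ¬ G.Adj q x := by
      by_contra! h6
      exact h4 a' b' ha1' ha2' hb1' hb2' hab' (h6 a' hza) hza.symm (h6 b' hzb) hzb.symm
    obtain ⟨p, hp, hp'⟩ := h5
    obtain ⟨q, hq, hq'⟩ := h6
    refine hc ⟨{(p, q)}, ⟨?_, by simp, by simp⟩, by simpa using by omega⟩
    intro r hr
    rw [mem_singleton] at hr
    subst hr
    exact ⟨hp, hq, hp', hq', hno p q hp hp' hq hq'⟩

lemma IsSquare.exists_of_not_credit_one (hreg : ∀ v, G.degree v = 4) (htf : TriangleFree G)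
    (h : IsSquare G x y z w) (hc : ¬ Credit G x z 1) :
    ∃ a b c d, IsSquare G a b c d ∧ Credit G a c 1 ∧ Credit G b d 1 := by
  have h3 : codegree G x z ≤ 2 := by
    by_contra! h4
    exact hc ⟨∅, by simp [IsFreeMatching], by rw [card_empty]; omega⟩
  have hxz := htf x y z h.xy h.yz
  obtain ⟨a, b, ha1, hb1, ha2, hb2, hab, hN⟩ := exists_neighbors' hreg h.xy h.wx.symm h.yw
  obtain ⟨a', b', ha1', hb1', ha2', hb2', hab', hN'⟩ := exists_neighbors' hreg h.yz.symm h.zw h.yw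
  have hxa : G.Adj x a := (hN a).2 (by simp)
  have hxb : G.Adj x b := (hN b).2 (by simp)
  have hza : G.Adj z a' := (hN' a').2 (by simp)
  have hzb : G.Adj z b' := (hN' b').2 (by simp)
  have h5 : ∀ t, t ≠ y → t ≠ w → G.Adj t x → ¬ G.Adj t z := fun t h6 h7 h8 h9 => by
    have := h.three_le_codegree h6 h7 h8 h9
    omega
  have key : ∀ p q, p ≠ y → p ≠ w → q ≠ y → q ≠ w → G.Adj x p → G.Adj z q → G.Adj p q := by
    intro p q h6 h7 h8 h9 hp hq
    by_contra hpq
    refine hc ⟨{(p, q)}, ⟨?_, by simp, by simp⟩, ?_⟩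
    · intro r hr
      rw [mem_singleton] at hr
      subst hr
      exact ⟨hp, hq, h5 p h6 h7 hp.symm, fun hqx => h5 q h8 h9 hqx hq.symm, hpq⟩
    · have := h.two_le_codegree
      rw [card_singleton]
      omega
  have hs : IsSquare G a a' b b' :=
    ⟨key a a' ha1 ha2 ha1' ha2' hxa hza, (key b a' hb1 hb2 ha1' ha2' hxb hza).symm,
      key b b' hb1 hb2 hb1' hb2' hxb hzb, (key a b' ha1 ha2 hb1' hb2' hxa hzb).symm, hab, hab'⟩
  refine ⟨a, a', b, b', hs, ⟨∅, by simp [IsFreeMatching], ?_⟩, ⟨∅, by simp [IsFreeMatching], ?_⟩⟩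
  · have := hs.three_le_codegree (t := x) (by rintro rfl; exact hxz hza.symm)
      (by rintro rfl; exact hxz hzb.symm) hxa hxb
    simpa using this
  · have := hs.reflect.three_le_codegree (t := z) (by rintro rfl; exact hxz hxa)
      (by rintro rfl; exact hxz hxb) hza hzb
    simpa using this

lemma IsSquare.exists_validOn_of_codegree (hreg : ∀ v, G.degree v = 4) (hG : G.Connected)
    (htf : TriangleFree G) (h : IsSquare G x y z w) (h1 : Credit G x z 1) (h2 : Credit G y w 1)
    (h3 : 3 ≤ codegree G x z) (hc : ¬ Credit G x z 2) (hyw : codegree G y w ≤ 3) :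
    ∃ ψ, ValidOn G G.edgeFinset ψ := by
  obtain ⟨-, p, q, hxp, hpz, hzq, hqx, hpq⟩ := h.exists_of_not_credit_two hreg hc
  obtain ⟨t, ht1, ht2, ht3, ht4⟩ := IsSquare.exists_of_three_le_codegree (y := y) (w := w) h3
  have hxz := htf x y z h.xy h.yz
  obtain ⟨a, b, ha1, hb1, ha2, hb2, hab, hN⟩ := exists_neighbors' hreg hxp.symm hpq
    (by rintro rfl; exact hxz hzq.symm)
  obtain ⟨a', b', -, -, -, -, -, hN'⟩ := exists_neighbors' hreg h.yz.symm h.zw h.yw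
  have hz : ∀ u, G.Adj p u → u ≠ q → ¬ G.Adj u z := by
    intro u hu huq huz
    have e1 : u ≠ y := by rintro rfl; exact htf x p u hxp hu h.xy
    have e2 : u ≠ w := by rintro rfl; exact htf x p u hxp hu h.wx.symm
    have e3 : u ≠ t := by rintro rfl; exact htf x p u hxp hu ht3.symm
    have e4 : q ≠ y := by rintro rfl; exact hqx h.xy.symm
    have e5 : q ≠ w := by rintro rfl; exact hqx h.wx
    have e6 : q ≠ t := by rintro rfl; exact hqx ht3
    have := (hN' u).1 huz.symm
    have := (hN' q).1 hzq
    have := (hN' t).1 ht4.symm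
    grind
  have hpa : G.Adj p a := (hN a).2 (by simp)
  have hpb : G.Adj p b := (hN b).2 (by simp)
  have haz := hz a hpa ha2
  have hbz := hz b hpb hb2
  by_cases ha : G.Adj a y ∧ G.Adj a w
  · refine h.exists_validOn_of_adj hreg hG htf h1 h2 hxp hpz hzq hpq hpb hb1 hbz fun hb => ?_
    have := h.reflect.four_le_codegree ha1 (by rintro rfl; exact hpz hpa) ha.1 ha.2 hb1
      (by rintro rfl; exact hpz hpb) hb.1 hb.2 hab
    omega
  · exact h.exists_validOn_of_adj hreg hG htf h1 h2 hxp hpz hzq hpq hpa ha1 haz ha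

lemma IsSquare.exists_validOn_of_credit_one (hreg : ∀ v, G.degree v = 4) (hG : G.Connected)
    (htf : TriangleFree G) (h : IsSquare G x y z w) (h1 : Credit G x z 1) (h2 : Credit G y w 1) :
    ∃ ψ, ValidOn G G.edgeFinset ψ := by
  by_cases hc : Credit G x z 2
  · exact h.exists_validOn_of_credit hreg hG htf hc h2
  by_cases hc' : Credit G y w 2
  · exact h.reflect.exists_validOn_of_credit hreg hG htf hc' h1
  obtain ⟨h3, p, q, hxp, hpz, hzq, hqx, hpq⟩ := h.exists_of_not_credit_two hreg hc
  obtain ⟨h3', -⟩ := h.reflect.exists_of_not_credit_two hreg hc'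
  rcases Nat.lt_or_ge 2 (codegree G x z) with h4 | h4
  · exact h.exists_validOn_of_codegree hreg hG htf h1 h2 h4 hc h3'
  rcases Nat.lt_or_ge 2 (codegree G y w) with h5 | h5
  · exact h.reflect.exists_validOn_of_codegree hreg hG htf h2 h1 h5 hc' h3
  have hxz := htf x y z h.xy h.yz
  obtain ⟨a, b, ha1, hb1, ha2, hb2, hab, hN⟩ := exists_neighbors' hreg hxp.symm hpq
    (by rintro rfl; exact hxz hzq.symm)
  obtain ⟨a', b', -, -, -, -, -, hN'⟩ := exists_neighbors' hreg h.yz.symm h.zw h.yw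
  have hpa : G.Adj p a := (hN a).2 (by simp)
  have hpb : G.Adj p b := (hN b).2 (by simp)
  have hyw : ∀ u, G.Adj p u → u ≠ x → ¬ (G.Adj u y ∧ G.Adj u w) := by
    intro u hu hux huyw
    have := h.reflect.three_le_codegree hux (by rintro rfl; exact hpz hu) huyw.1 huyw.2
    omega
  have hne : ∀ u, G.Adj p u → u ≠ y ∧ u ≠ w := fun u hu =>
    ⟨by rintro rfl; exact htf x p u hxp hu h.xy, by rintro rfl; exact htf x p u hxp hu h.wx.symm⟩
  by_cases haz : G.Adj a z
  · refine h.exists_validOn_of_adj hreg hG htf h1 h2 hxp hpz hzq hpq hpb hb1 (fun hbz => ?_)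
      (hyw b hpb hb1)
    have := (hN' a).1 haz.symm
    have := (hN' b).1 hbz.symm
    have := (hN' q).1 hzq
    have := hne a hpa
    have := hne b hpb
    have := hne q hpq
    grind
  · exact h.exists_validOn_of_adj hreg hG htf h1 h2 hxp hpz hzq hpq hpa ha1 haz (hyw a hpa ha1)

/-- A connected triangle-free graph with a cycle of length four has a coloring. -/
theorem IsSquare.exists_validOn_edgeFinset (hreg : ∀ v, G.degree v = 4) (hG : G.Connected)
    (htf : TriangleFree G) (h : IsSquare G x y z w) : ∃ ψ, ValidOn G G.edgeFinset ψ := by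
  by_cases h1 : Credit G x z 1
  · by_cases h2 : Credit G y w 1
    · exact h.exists_validOn_of_credit_one hreg hG htf h1 h2
    · obtain ⟨a, b, c, d, hs, h3, h4⟩ := h.reflect.exists_of_not_credit_one hreg htf h2
      exact hs.exists_validOn_of_credit_one hreg hG htf h3 h4
  · obtain ⟨a, b, c, d, hs, h3, h4⟩ := h.exists_of_not_credit_one hreg htf h1
    exact hs.exists_validOn_of_credit_one hreg hG htf h3 h4

end StrongEdge

namespace StrongEdge

open Finset

/-- Distinct vertices have at most one common neighbor. -/
def SquareFree {V : Type*} (G : SimpleGraph V) : Prop :=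
  ∀ a b c d, G.Adj a c → G.Adj b c → G.Adj a d → G.Adj b d → a ≠ b → c = d

lemma squareFree_of_forall_not_isSquare {V : Type*} {G : SimpleGraph V}
    (h : ∀ x y z w, ¬ IsSquare G x y z w) : SquareFree G := by
  intro a b c d hac hbc had hbd hab
  by_contra hcd
  exact h a c b d ⟨hac, hbc.symm, hbd, had.symm, hab, hcd⟩

/-- Three neighbors `y k` of `v`, each with two further neighbors `l k false` and `l k true`, such
that edges `s(y k, l k b)` with equal `b` do not conflict. -/
structure IsConfig {V : Type*} (G : SimpleGraph V) (v : V) (y : Fin 3 → V)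
    (l : Fin 3 → Bool → V) : Prop where
  adj : ∀ k, G.Adj v (y k)
  inj : Function.Injective y
  adj_leaf : ∀ k b, G.Adj (y k) (l k b)
  leaf_ne : ∀ k b, l k b ≠ v
  inj_leaf : ∀ k, Function.Injective (l k)
  not_adj : ∀ i j b, ¬ G.Adj (l i b) (l j b)

lemma exists_pair {α : Type*} {d e f : α} (hde : d ≠ e) (hdf : d ≠ f) (hef : e ≠ f)
    {A B : α → Prop} (hA : ∀ x ∈ ({d, e, f} : Set α), ∀ y ∈ ({d, e, f} : Set α), A x → A y → x = y)
    (hB : ∀ x ∈ ({d, e, f} : Set α), ∀ y ∈ ({d, e, f} : Set α), B x → B y → x = y)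
    (hAB : ∀ x ∈ ({d, e, f} : Set α), A x → ¬ B x) :
    ∃ s ∈ ({d, e, f} : Set α), ∃ t ∈ ({d, e, f} : Set α), s ≠ t ∧ ¬ A s ∧ ¬ B t ∧
      (B s ∨ ∀ x ∈ ({d, e, f} : Set α), ¬ B x) ∧ (A t ∨ ∀ x ∈ ({d, e, f} : Set α), ¬ A x) := by
  simp only [Set.mem_insert_iff, Set.mem_singleton_iff, forall_eq_or_imp, forall_eq,
    exists_eq_or_imp, exists_eq_left] at *
  grind

lemma exists_pair_avoiding {α : Type*} {d e f : α} (hde : d ≠ e) (hdf : d ≠ f) (hef : e ≠ f)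
    {A B M N : α → Prop}
    (hA : ∀ x ∈ ({d, e, f} : Set α), ∀ y ∈ ({d, e, f} : Set α), A x → A y → x = y)
    (hB : ∀ x ∈ ({d, e, f} : Set α), ∀ y ∈ ({d, e, f} : Set α), B x → B y → x = y)
    (hM : ∀ x ∈ ({d, e, f} : Set α), ∀ y ∈ ({d, e, f} : Set α), M x → M y → x = y)
    (hN : ∀ x ∈ ({d, e, f} : Set α), ∀ y ∈ ({d, e, f} : Set α), N x → N y → x = y)
    (hAB : ∀ x ∈ ({d, e, f} : Set α), A x → ¬ B x) (hMN : ∀ x ∈ ({d, e, f} : Set α), M x → ¬ N x)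
    (h : ¬ ((∃ x ∈ ({d, e, f} : Set α), A x ∧ N x) ∧ ∃ x ∈ ({d, e, f} : Set α), B x ∧ M x)) :
    ∃ s ∈ ({d, e, f} : Set α), ∃ t ∈ ({d, e, f} : Set α),
      s ≠ t ∧ ¬ A s ∧ ¬ M s ∧ ¬ B t ∧ ¬ N t := by
  simp only [Set.mem_insert_iff, Set.mem_singleton_iff, forall_eq_or_imp, forall_eq,
    exists_eq_or_imp, exists_eq_left] at *
  grind

variable {V : Type*} [Fintype V] [DecidableEq V] {G : SimpleGraph V} [DecidableRel G.Adj]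
  {v z₁ z₂ z₃ q : V}

lemma exists_leaves (hreg : ∀ v, G.degree v = 4) (htf : TriangleFree G) (hsf : SquareFree G)
    (h1 : G.Adj v z₁) (h2 : G.Adj v z₂) (h3 : G.Adj v z₃) (h23 : z₂ ≠ z₃) (h12 : z₁ ≠ z₂)
    (h13 : z₁ ≠ z₃) (q : V) :
    ∃ a b, ∃ s₂ t₂ s₃ t₃, (a ≠ b ∧ s₂ ≠ t₂ ∧ s₃ ≠ t₃) ∧
      (G.Adj z₁ a ∧ G.Adj z₁ b ∧ G.Adj z₂ s₂ ∧ G.Adj z₂ t₂ ∧ G.Adj z₃ s₃ ∧ G.Adj z₃ t₃) ∧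
      (a ≠ v ∧ b ≠ v ∧ s₂ ≠ v ∧ t₂ ≠ v ∧ s₃ ≠ v ∧ t₃ ≠ v) ∧
      (¬ G.Adj a s₂ ∧ ¬ G.Adj a s₃ ∧ ¬ G.Adj s₂ s₃) ∧
      (¬ G.Adj b t₂ ∧ ¬ G.Adj b t₃ ∧ ¬ G.Adj t₂ t₃) ∧
      a ≠ q ∧ b ≠ q := by
  have n12 : ¬ G.Adj z₁ z₂ := htf z₁ v z₂ h1.symm h2
  have n13 : ¬ G.Adj z₁ z₃ := htf z₁ v z₃ h1.symm h3
  have n23 : ¬ G.Adj z₂ z₃ := htf z₂ v z₃ h2.symm h3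
  obtain ⟨a, b, hab, ha, hb, hav, hbv, haq, hbq⟩ : ∃ a b, a ≠ b ∧ G.Adj z₁ a ∧ G.Adj z₁ b ∧
      a ≠ v ∧ b ≠ v ∧ a ≠ q ∧ b ≠ q := by
    obtain ⟨a, b, c, h4, h5, h6, h7, h8, h9, h10⟩ := exists_neighbors hreg h1.symm
    have ha : G.Adj z₁ a := (h10 a).2 (by simp)
    have hb : G.Adj z₁ b := (h10 b).2 (by simp)
    have hc : G.Adj z₁ c := (h10 c).2 (by simp)
    by_cases haq : a = q
    · exact ⟨b, c, h9, hb, hc, h5, h6, haq ▸ h7.symm, haq ▸ h8.symm⟩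
    by_cases hbq : b = q
    · exact ⟨a, c, h8, ha, hc, h4, h6, haq, hbq ▸ h9.symm⟩
    exact ⟨a, b, h7, ha, hb, h4, h5, haq, hbq⟩
  obtain ⟨d, d', d'', hd1, hd2, hd3, hd4, hd5, hd6, hd⟩ := exists_neighbors hreg h2.symm
  obtain ⟨e, e', e'', he1, he2, he3, he4, he5, he6, he⟩ := exists_neighbors hreg h3.symm
  have hD : ∀ x ∈ ({d, d', d''} : Set V), G.Adj z₂ x ∧ x ≠ v := by
    intro x hx
    rw [hd]
    simp only [Set.mem_insert_iff, Set.mem_singleton_iff] at hx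
    grind
  have hE : ∀ x ∈ ({e, e', e''} : Set V), G.Adj z₃ x ∧ x ≠ v := by
    intro x hx
    rw [he]
    simp only [Set.mem_insert_iff, Set.mem_singleton_iff] at hx
    grind
  have uD : ∀ u, u ≠ z₂ → ∀ x ∈ ({d, d', d''} : Set V), ∀ y ∈ ({d, d', d''} : Set V),
      G.Adj u x → G.Adj u y → x = y := fun u hu x hx y hy hux huy =>
    hsf u z₂ x y hux (hD x hx).1 huy (hD y hy).1 hu
  have uE : ∀ u, u ≠ z₃ → ∀ x ∈ ({e, e', e''} : Set V), ∀ y ∈ ({e, e', e''} : Set V),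
      G.Adj u x → G.Adj u y → x = y := fun u hu x hx y hy hux huy =>
    hsf u z₃ x y hux (hE x hx).1 huy (hE y hy).1 hu
  have ha2 : a ≠ z₂ := by rintro rfl; exact n12 ha
  have hb2 : b ≠ z₂ := by rintro rfl; exact n12 hb
  have ha3 : a ≠ z₃ := by rintro rfl; exact n13 ha
  have hb3 : b ≠ z₃ := by rintro rfl; exact n13 hb
  have dE : ∀ x ∈ ({e, e', e''} : Set V), G.Adj a x → ¬ G.Adj b x := by
    intro x hx hax hbx
    have := hsf a b x z₁ hax hbx ha.symm hb.symm hab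
    exact n13 (this ▸ (hE x hx).1).symm
  obtain ⟨s, hs, t, ht, hst, has, hbt, hbs, hat⟩ := exists_pair hd4 hd5 hd6
    (A := fun u => G.Adj a u) (B := fun u => G.Adj b u) (uD a ha2) (uD b hb2) (by
      intro x hx hax hbx
      have := hsf a b x z₁ hax hbx ha.symm hb.symm hab
      exact n12 (this ▸ (hD x hx).1).symm)
  have hs3 : s ≠ z₃ := by rintro rfl; exact n23 (hD s hs).1
  have ht3 : t ≠ z₃ := by rintro rfl; exact n23 (hD t ht).1
  have dM : ∀ x ∈ ({e, e', e''} : Set V), G.Adj s x → ¬ G.Adj t x := by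
    intro x hx hax hbx
    have := hsf s t x z₂ hax hbx (hD s hs).1.symm (hD t ht).1.symm hst
    exact n23 (this ▸ (hE x hx).1).symm
  by_cases hbad : (∃ x ∈ ({e, e', e''} : Set V), G.Adj a x ∧ G.Adj t x) ∧
      ∃ x ∈ ({e, e', e''} : Set V), G.Adj b x ∧ G.Adj s x
  · obtain ⟨⟨x, hx, hax, htx⟩, x', hx', hbx, hsx⟩ := hbad
    have hbD : ∀ x ∈ ({d, d', d''} : Set V), ¬ G.Adj b x :=
      hbs.resolve_left fun hc => htf b s x' hc hsx hbx
    have haD : ∀ x ∈ ({d, d', d''} : Set V), ¬ G.Adj a x :=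
      hat.resolve_left fun hc => htf a t x hc htx hax
    refine ⟨a, b, t, s, x', x, ⟨hab, hst.symm, ?_⟩,
      ⟨ha, hb, (hD t ht).1, (hD s hs).1, (hE x' hx').1, (hE x hx).1⟩,
      ⟨hav, hbv, (hD t ht).2, (hD s hs).2, (hE x' hx').2, (hE x hx).2⟩,
      ⟨haD t ht, ?_, ?_⟩, ⟨hbD s hs, dE x hx hax, fun hc => dM x hx hc htx⟩, haq, hbq⟩
    · rintro rfl
      exact dE x' hx' hax hbx
    · exact fun hc => dE x' hx' hc hbx
    · exact dM x' hx' hsx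
  · obtain ⟨s', hs', t', ht', hst', h4, h5, h6, h7⟩ := exists_pair_avoiding he4 he5 he6
      (A := fun u => G.Adj a u) (B := fun u => G.Adj b u) (M := fun u => G.Adj s u)
      (N := fun u => G.Adj t u) (uE a ha3) (uE b hb3) (uE s hs3) (uE t ht3) dE dM hbad
    exact ⟨a, b, s, t, s', t', ⟨hab, hst, hst'⟩, ⟨ha, hb, (hD s hs).1, (hD t ht).1, (hE s' hs').1,
      (hE t' ht').1⟩, ⟨hav, hbv, (hD s hs).2, (hD t ht).2, (hE s' hs').2, (hE t' ht').2⟩,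
      ⟨has, h4, h5⟩, ⟨hbt, h6, h7⟩, haq, hbq⟩

/-- Three neighbors of `v` extend to a configuration that avoids `q` among the leaves. -/
lemma exists_isConfig (hreg : ∀ v, G.degree v = 4) (htf : TriangleFree G) (hsf : SquareFree G)
    (h1 : G.Adj v z₁) (h2 : G.Adj v z₂) (h3 : G.Adj v z₃) (h23 : z₂ ≠ z₃) (h12 : z₁ ≠ z₂)
    (h13 : z₁ ≠ z₃) (q : V) :
    ∃ y l, IsConfig G v y l ∧ (∀ k, y k = z₁ ∨ y k = z₂ ∨ y k = z₃) ∧ ∀ k b, l k b ≠ q := by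
  have main : ∀ z₁ z₂ z₃ : V, G.Adj v z₁ → G.Adj v z₂ → G.Adj v z₃ → z₂ ≠ z₃ → z₁ ≠ z₂ → z₁ ≠ z₃ →
      (∀ z, z = z₂ ∨ z = z₃ → G.Adj z q → q = v) →
      ∃ y l, IsConfig G v y l ∧ (∀ k, y k = z₁ ∨ y k = z₂ ∨ y k = z₃) ∧ ∀ k b, l k b ≠ q := by
    intro z₁ z₂ z₃ h1 h2 h3 h23 h12 h13 hq
    obtain ⟨a, b, s₂, t₂, s₃, t₃, ⟨e1, e2, e3⟩, ⟨a1, a2, a3, a4, a5, a6⟩, ⟨n1, n2, n3, n4, n5, n6⟩,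
      ⟨m1, m2, m3⟩, ⟨m4, m5, m6⟩, q1, q2⟩ := exists_leaves hreg htf hsf h1 h2 h3 h23 h12 h13 q
    refine ⟨![z₁, z₂, z₃], ![fun b' => cond b' b a, fun b' => cond b' t₂ s₂,
      fun b' => cond b' t₃ s₃], ⟨?_, ?_, ?_, ?_, ?_, ?_⟩, ?_, ?_⟩
    · intro k; fin_cases k <;> assumption
    · intro i j hij; fin_cases i <;> fin_cases j <;> simp_all
    · intro k b; fin_cases k <;> cases b <;> assumption
    · intro k b; fin_cases k <;> cases b <;> assumption
    · intro k b b' hb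
      fin_cases k <;> cases b <;> cases b' <;>
        first | rfl | exact absurd hb (by simpa) | exact absurd hb.symm (by simpa)
    · intro i j b hadj
      fin_cases i <;> fin_cases j <;> cases b <;>
        first | exact G.irrefl hadj | exact absurd hadj (by assumption) |
          exact absurd hadj.symm (by assumption)
    · intro k; fin_cases k <;> simp
    · intro k b hb
      have h5 : q = v → False := by
        rintro rfl
        fin_cases k <;> cases b <;> contradiction
      fin_cases k <;> cases b
      · exact q1 hb
      · exact q2 hb
      · exact h5 (hq z₂ (Or.inl rfl) (hb ▸ a3))
      · exact h5 (hq z₂ (Or.inl rfl) (hb ▸ a4))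
      · exact h5 (hq z₃ (Or.inr rfl) (hb ▸ a5))
      · exact h5 (hq z₃ (Or.inr rfl) (hb ▸ a6))
  have key : ∀ z z', z ≠ z' → G.Adj v z → G.Adj v z' → G.Adj z q → G.Adj z' q → q = v :=
    fun z z' hne hz hz' hzq hzq' => hsf z z' q v hzq hzq' hz.symm hz'.symm hne
  by_cases hq1 : G.Adj z₁ q
  · exact main z₁ z₂ z₃ h1 h2 h3 h23 h12 h13 (by
      rintro z (rfl | rfl) hz
      · exact key _ _ h12 h1 h2 hq1 hz
      · exact key _ _ h13 h1 h3 hq1 hz)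
  by_cases hq2 : G.Adj z₂ q
  · obtain ⟨y, l, h4, h5, h6⟩ := main z₂ z₁ z₃ h2 h1 h3 h13 h12.symm h23 (by
      rintro z (rfl | rfl) hz
      · exact absurd hz hq1
      · exact key _ _ h23 h2 h3 hq2 hz)
    exact ⟨y, l, h4, fun k => by have := h5 k; tauto, h6⟩
  · obtain ⟨y, l, h4, h5, h6⟩ := main z₃ z₁ z₂ h3 h1 h2 h12 h13.symm h23.symm (by
      rintro z (rfl | rfl) hz
      · exact absurd hz hq1
      · exact absurd hz hq2)
    exact ⟨y, l, h4, fun k => by have := h5 k; tauto, h6⟩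

end StrongEdge

namespace StrongEdge

open Finset

/-- The vertex `u` can be reached from `r` outside `W`. -/
def ReachAvoiding {V : Type*} (G : SimpleGraph V) (W : Finset V) (r u : V) : Prop :=
  Relation.ReflTransGen (fun a b => G.Adj a b ∧ a ∉ W ∧ b ∉ W) r u

lemma ReachAvoiding.not_mem {V : Type*} {G : SimpleGraph V} {W : Finset V} {r u : V}
    (h : ReachAvoiding G W r u) (hr : r ∉ W) : u ∉ W := by
  rcases Relation.ReflTransGen.cases_tail h with rfl | ⟨c, -, -, -, hu⟩
  · exact hr
  · exact hu

lemma ReachAvoiding.tail {V : Type*} {G : SimpleGraph V} {W : Finset V} {r u u' : V}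
    (h : ReachAvoiding G W r u) (hr : r ∉ W) (hadj : G.Adj u u') (hu' : u' ∉ W) :
    ReachAvoiding G W r u' :=
  Relation.ReflTransGen.tail h ⟨hadj, h.not_mem hr, hu'⟩

/-- The vertices of a configuration other than its center. -/
def support {V : Type*} [DecidableEq V] (y : Fin 3 → V) (l : Fin 3 → Bool → V) : Finset V :=
  univ.image y ∪ univ.image fun p : Fin 3 × Bool => l p.1 p.2

lemma mem_support {V : Type*} [DecidableEq V] {y : Fin 3 → V} {l : Fin 3 → Bool → V} {u : V} :
    u ∈ support y l ↔ (∃ k, y k = u) ∨ ∃ k b, l k b = u := by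
  simp [support]

lemma mem_support_left {V : Type*} [DecidableEq V] {y : Fin 3 → V} {l : Fin 3 → Bool → V}
    (k : Fin 3) : y k ∈ support y l :=
  mem_support.2 (Or.inl ⟨k, rfl⟩)

lemma mem_support_right {V : Type*} [DecidableEq V] {y : Fin 3 → V} {l : Fin 3 → Bool → V}
    (k : Fin 3) (b : Bool) : l k b ∈ support y l :=
  mem_support.2 (Or.inr ⟨k, b, rfl⟩)

lemma IsConfig.center_not_mem {V : Type*} [DecidableEq V] {G : SimpleGraph V} {v : V}
    {y : Fin 3 → V} {l : Fin 3 → Bool → V} (h : IsConfig G v y l) : v ∉ support y l := by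
  rw [mem_support]
  rintro (⟨k, hk⟩ | ⟨k, b, hk⟩)
  · exact (h.adj k).ne hk.symm
  · exact h.leaf_ne k b hk

variable {V : Type*} [Fintype V] [DecidableEq V] {G : SimpleGraph V} [DecidableRel G.Adj]
  {v r : V} {y : Fin 3 → V} {l : Fin 3 → Bool → V}

/-- A configuration together with a vertex `r` outside of it, such that the number of vertices
that can be reached from `r` outside the configuration is maximal. -/
def IsMaxConfig (G : SimpleGraph V) (v : V) (y : Fin 3 → V) (l : Fin 3 → Bool → V) (r : V) :
    Prop :=
  IsConfig G v y l ∧ r ∉ support y l ∧ ∀ v' y' l' r', IsConfig G v' y' l' → r' ∉ support y' l' →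
    {u | ReachAvoiding G (support y' l') r' u}.ncard ≤
      {u | ReachAvoiding G (support y l) r u}.ncard

lemma exists_isMaxConfig (hreg : ∀ v, G.degree v = 4) (htf : TriangleFree G)
    (hsf : SquareFree G) (v : V) : ∃ v y l r, IsMaxConfig G v y l r := by
  have hv : 0 < G.degree v := by rw [hreg]; omega
  obtain ⟨x, hx⟩ := (G.degree_pos_iff_exists_adj v).1 hv
  obtain ⟨a, b, c, ha, hb, -, hab, -, -, hN⟩ := exists_neighbors hreg hx
  obtain ⟨y, l, hc, -, -⟩ := exists_isConfig hreg htf hsf hx ((hN a).2 (by simp))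
    ((hN b).2 (by simp)) hab ha.symm hb.symm v
  obtain ⟨⟨v, y, l, r⟩, hm, hmax⟩ := Set.exists_max_image
    {p : V × (Fin 3 → V) × (Fin 3 → Bool → V) × V |
      IsConfig G p.1 p.2.1 p.2.2.1 ∧ p.2.2.2 ∉ support p.2.1 p.2.2.1}
    (fun p => {u | ReachAvoiding G (support p.2.1 p.2.2.1) p.2.2.2 u}.ncard)
    (Set.toFinite _) ⟨(v, y, l, v), hc, hc.center_not_mem⟩
  exact ⟨v, y, l, r, hm.1, hm.2, fun v' y' l' r' h h' => hmax (v', y', l', r') ⟨h, h'⟩⟩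

/-- The vertex `z` and its neighbors avoid `C`. -/
def Deep {V : Type*} (G : SimpleGraph V) (C : V → Prop) (z : V) : Prop :=
  ¬ C z ∧ ∀ u, G.Adj z u → ¬ C u

lemma IsMaxConfig.false_of_deep (hreg : ∀ v, G.degree v = 4) (hG : G.Connected)
    (htf : TriangleFree G) (hsf : SquareFree G) (h : IsMaxConfig G v y l r) {v' z₁ z₂ z₃ : V}
    (h1 : G.Adj v' z₁) (h2 : G.Adj v' z₂) (h3 : G.Adj v' z₃) (h23 : z₂ ≠ z₃) (h12 : z₁ ≠ z₂)
    (h13 : z₁ ≠ z₃) (hd1 : Deep G (ReachAvoiding G (support y l) r) z₁)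
    (hd2 : Deep G (ReachAvoiding G (support y l) r) z₂)
    (hd3 : Deep G (ReachAvoiding G (support y l) r) z₃) : False := by
  obtain ⟨-, hr, hmax⟩ := h
  set C := ReachAvoiding G (support y l) r
  have hCr : C r := Relation.ReflTransGen.refl
  obtain ⟨c, q, hcq, hc, hq⟩ : ∃ c q, G.Adj c q ∧ C c ∧ ¬ C q := by
    by_contra! hno
    have hall : ∀ u, C u := fun u => by
      have h := (SimpleGraph.reachable_iff_reflTransGen r u).1 (hG.preconnected r u)
      induction h with
      | refl => exact hCr
      | tail _ hbc ih => exact hno _ _ hbc ih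
    exact hd1.1 (hall z₁)
  obtain ⟨y', l', hc', hy', hl'⟩ := exists_isConfig hreg htf hsf h1 h2 h3 h23 h12 h13 q
  have hdeep : ∀ k, Deep G C (y' k) := by
    intro k
    rcases hy' k with hk | hk | hk <;> rw [hk] <;> assumption
  have hCW : ∀ u, C u → u ∉ support y' l' := by
    intro u hu hW
    rcases mem_support.1 hW with ⟨k, rfl⟩ | ⟨k, b, rfl⟩
    · exact (hdeep k).1 hu
    · exact (hdeep k).2 _ (hc'.adj_leaf k b) hu
  have hqW : q ∉ support y' l' := by
    intro hW
    rcases mem_support.1 hW with ⟨k, rfl⟩ | ⟨k, b, hk⟩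
    · exact (hdeep k).2 _ hcq.symm hc
    · exact hl' k b hk
  have hsub : ∀ u, C u → ReachAvoiding G (support y' l') r u := by
    intro u hu
    induction hu with
    | refl => exact Relation.ReflTransGen.refl
    | tail hab hbc ih =>
      exact ih.tail (hCW r hCr) hbc.1 (hCW _ (Relation.ReflTransGen.tail hab hbc))
  have hlt := hmax v' y' l' r hc' (hCW r hCr)
  refine absurd hlt (not_le.2 (Set.ncard_lt_ncard ⟨hsub, fun hle => hq (hle ?_)⟩ (Set.toFinite _)))
  exact (hsub c hc).tail (hCW r hCr) hcq hqW

lemma exists_fourth_neighbor (hreg : ∀ v, G.degree v = 4) (v : V) (y : Fin 3 → V) :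
    ∃ u, G.Adj v u ∧ ∀ k, u ≠ y k := by
  by_contra! hno
  have hsub : G.neighborFinset v ⊆ univ.image y := by
    intro u hu
    obtain ⟨k, hk⟩ := hno u (by simpa using hu)
    exact mem_image.2 ⟨k, mem_univ _, hk.symm⟩
  have h1 := Finset.card_le_card hsub
  have h2 : (univ.image y).card ≤ _ := Finset.card_image_le
  rw [G.card_neighborFinset_eq_degree, hreg] at h1
  rw [Finset.card_univ, Fintype.card_fin] at h2
  omega

lemma IsMaxConfig.reach_center (hreg : ∀ v, G.degree v = 4) (hG : G.Connected)
    (htf : TriangleFree G) (hsf : SquareFree G) (h : IsMaxConfig G v y l r) :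
    ReachAvoiding G (support y l) r v := by
  by_contra hv
  obtain ⟨hc, hr, -⟩ := id h
  obtain ⟨u, hvu, hu⟩ := exists_fourth_neighbor hreg v y
  have hW : u ∉ support y l := by
    rw [mem_support]
    rintro (⟨k, hk⟩ | ⟨k, b, rfl⟩)
    · exact hu k hk.symm
    · exact htf v (y k) _ (hc.adj k) (hc.adj_leaf k b) hvu
  have hu' : ¬ ReachAvoiding G (support y l) r u := fun hu' =>
    hv (hu'.tail hr hvu.symm hc.center_not_mem)
  obtain ⟨a, b, c, ha, hb, hc', hab, hac, hbc, hN⟩ := exists_neighbors hreg hvu.symm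
  have key : ∀ z, G.Adj u z → z ≠ v → Deep G (ReachAvoiding G (support y l) r) z := by
    intro z hz hzv
    have hzW : z ∉ support y l := by
      rw [mem_support]
      rintro (⟨k, rfl⟩ | ⟨k, b, rfl⟩)
      · exact htf v u _ hvu hz (hc.adj k)
      · exact hu k (hsf v (l k b) u (y k) hvu hz.symm (hc.adj k) (hc.adj_leaf k b).symm hzv.symm)
    have hzC : ¬ ReachAvoiding G (support y l) r z := fun hzC => hu' (hzC.tail hr hz.symm hW)
    exact ⟨hzC, fun t ht htC => hzC (htC.tail hr ht.symm hzW)⟩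
  have hua := (hN a).2 (by simp)
  have hub := (hN b).2 (by simp)
  have huc := (hN c).2 (by simp)
  exact h.false_of_deep hreg hG htf hsf hua hub huc hbc hab hac (key a hua ha) (key b hub hb)
    (key c huc hc')

lemma IsMaxConfig.exists_two_neighbors (hreg : ∀ v, G.degree v = 4) (hG : G.Connected)
    (htf : TriangleFree G) (hsf : SquareFree G) (h : IsMaxConfig G v y l r) {x : V}
    (hx : x ∉ support y l) (hxC : ¬ ReachAvoiding G (support y l) r x) :
    ∃ p p' u u', p ≠ p' ∧ G.Adj x p ∧ G.Adj x p' ∧ p ∈ support y l ∧ p' ∈ support y l ∧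
      G.Adj p u ∧ ReachAvoiding G (support y l) r u ∧ G.Adj p' u' ∧
      ReachAvoiding G (support y l) r u' := by
  obtain ⟨hc, hr, -⟩ := id h
  have hnb : ∀ z, G.Adj x z → ¬ ReachAvoiding G (support y l) r z := fun z hz hzC =>
    hxC (hzC.tail hr hz.symm hx)
  have key : ∀ z, G.Adj x z → ¬ Deep G (ReachAvoiding G (support y l) r) z →
      z ∈ support y l ∧ ∃ u, G.Adj z u ∧ ReachAvoiding G (support y l) r u := by
    intro z hz hzd
    have hzC := hnb z hz
    have hex : ∃ u, G.Adj z u ∧ ReachAvoiding G (support y l) r u := by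
      by_contra! hno
      exact hzd ⟨hzC, hno⟩
    refine ⟨?_, hex⟩
    by_contra hzW
    obtain ⟨u, hu, huC⟩ := hex
    exact hzC (huC.tail hr hu.symm hzW)
  have hv : 0 < G.degree x := by rw [hreg]; omega
  obtain ⟨d, hd⟩ := (G.degree_pos_iff_exists_adj x).1 hv
  obtain ⟨a, b, c, had, hbd, hcd, hab, hac, hbc, hN⟩ := exists_neighbors hreg hd
  have ha := (hN a).2 (by simp)
  have hb := (hN b).2 (by simp)
  have hc := (hN c).2 (by simp)
  have hthree := fun z₁ z₂ z₃ h1 h2 h3 h23 h12 h13 => h.false_of_deep hreg hG htf hsf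
    (v' := x) (z₁ := z₁) (z₂ := z₂) (z₃ := z₃) h1 h2 h3 h23 h12 h13
  have hpair : ∃ p p', p ≠ p' ∧ G.Adj x p ∧ G.Adj x p' ∧
      ¬ Deep G (ReachAvoiding G (support y l) r) p ∧
      ¬ Deep G (ReachAvoiding G (support y l) r) p' := by
    by_contra! hno
    have e1 := hno a b hab ha hb
    have e2 := hno a c hac ha hc
    have e3 := hno a d had ha hd
    have e4 := hno b c hbc hb hc
    have e5 := hno b d hbd hb hd
    have e6 := hno c d hcd hc hd
    have f1 := hthree a b c ha hb hc hbc hab hac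
    have f2 := hthree a b d ha hb hd hbd hab had
    have f3 := hthree a c d ha hc hd hcd hac had
    have f4 := hthree b c d hb hc hd hcd hbc hbd
    by_cases da : Deep G (ReachAvoiding G (support y l) r) a
    · by_cases db : Deep G (ReachAvoiding G (support y l) r) b
      · exact f1 da db (by_contra fun hd => f2 da db (e6 hd))
      · exact f3 da (e4 db) (e5 db)
    · exact f4 (e1 da) (e2 da) (e3 da)
  obtain ⟨p, p', hne, hp, hp', hpd, hpd'⟩ := hpair
  obtain ⟨hpW, u, hu, huC⟩ := key p hp hpd
  obtain ⟨hpW', u', hu', huC'⟩ := key p' hp' hpd'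
  exact ⟨p, p', u, u', hne, hp, hp', hpW, hpW', hu, huC, hu', huC'⟩

end StrongEdge

namespace StrongEdge

open Finset

/-- The edges from the middle vertices of a configuration to its leaves. -/
def pattern {V : Type*} [DecidableEq V] (y : Fin 3 → V) (l : Fin 3 → Bool → V) : Finset (Sym2 V) :=
  univ.image fun p : Fin 3 × Bool => s(y p.1, l p.1 p.2)

open Classical in
/-- The two-coloring of the pattern. -/
noncomputable def patternColor {V : Type*} (y : Fin 3 → V) (l : Fin 3 → Bool → V) (e : Sym2 V) :
    Fin 21 :=
  if ∃ k, e = s(y k, l k true) then 1 else 0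

section

variable {V : Type*} [DecidableEq V] {G : SimpleGraph V} {v : V} {y : Fin 3 → V}
  {l : Fin 3 → Bool → V}

lemma mem_pattern {e : Sym2 V} : e ∈ pattern y l ↔ ∃ k b, e = s(y k, l k b) := by
  simp only [pattern, mem_image, mem_univ, true_and, Prod.exists, eq_comm]

lemma not_mem_pattern {x z : V} (hx : x ∉ support y l) : s(x, z) ∉ pattern y l := by
  rw [mem_pattern]
  rintro ⟨k, b, h⟩
  rcases Sym2.eq_iff.1 h with ⟨rfl, -⟩ | ⟨rfl, -⟩
  · exact hx (mem_support_left k)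
  · exact hx (mem_support_right k b)

end

namespace IsConfig

variable {V : Type*} {G : SimpleGraph V} {v : V} {y : Fin 3 → V} {l : Fin 3 → Bool → V}

lemma y_not_adj (htf : TriangleFree G) (h : IsConfig G v y l) (i j : Fin 3) :
    ¬ G.Adj (y i) (y j) :=
  htf _ v _ (h.adj i).symm (h.adj j)

lemma y_ne_leaf (htf : TriangleFree G) (h : IsConfig G v y l) (i j : Fin 3) (b : Bool) :
    y i ≠ l j b :=
  fun heq => h.y_not_adj htf j i (heq ▸ h.adj_leaf j b)

lemma eq_of_adj_leaf (hsf : SquareFree G) (h : IsConfig G v y l) {i j : Fin 3} {b : Bool}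
    (hadj : G.Adj (y i) (l j b)) : i = j :=
  h.inj (hsf v (l j b) _ _ (h.adj i) hadj.symm (h.adj j) (h.adj_leaf j b).symm (h.leaf_ne j b).symm)

lemma leaf_inj (hsf : SquareFree G) (h : IsConfig G v y l) {i j : Fin 3} {b c : Bool}
    (heq : l i b = l j c) : i = j ∧ b = c := by
  obtain rfl := h.eq_of_adj_leaf hsf (heq ▸ h.adj_leaf i b)
  exact ⟨rfl, h.inj_leaf i heq⟩

lemma edge_inj (htf : TriangleFree G) (h : IsConfig G v y l) {i j : Fin 3} {b c : Bool}
    (heq : s(y i, l i b) = s(y j, l j c)) : i = j ∧ b = c := by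
  rcases Sym2.eq_iff.1 heq with ⟨h1, h2⟩ | ⟨h1, -⟩
  · obtain rfl := h.inj h1
    exact ⟨rfl, h.inj_leaf i h2⟩
  · exact absurd h1 (h.y_ne_leaf htf i j c)

lemma patternColor_eq (htf : TriangleFree G) (h : IsConfig G v y l) (i : Fin 3) (b : Bool) :
    patternColor y l s(y i, l i b) = cond b 1 0 := by
  unfold patternColor
  cases b
  · rw [if_neg]
    · rfl
    · rintro ⟨k, hk⟩
      exact absurd (h.edge_inj htf hk).2 (by simp)
  · rw [if_pos ⟨i, rfl⟩]
    rfl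

end IsConfig

variable {V : Type*} [Fintype V] [DecidableEq V] {G : SimpleGraph V} [DecidableRel G.Adj]
  {v r : V} {y : Fin 3 → V} {l : Fin 3 → Bool → V} {A P : Finset (Sym2 V)} {ψ₀ : Sym2 V → Fin 21}

lemma IsConfig.validOn (htf : TriangleFree G) (hsf : SquareFree G) (h : IsConfig G v y l) :
    ValidOn G (pattern y l) (patternColor y l) := by
  intro e he f hf hef
  obtain ⟨i, b, rfl⟩ := mem_pattern.1 he
  obtain ⟨j, c, rfl⟩ := mem_pattern.1 hf
  rw [h.patternColor_eq htf, h.patternColor_eq htf]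
  by_cases hbc : b = c
  · subst hbc
    have hij : j ≠ i := by rintro rfl; exact (mem_nbhd.1 hef).2.1 rfl
    obtain ⟨-, -, h1⟩ := mem_nbhd_edges.1 hef
    rcases h1 with (h1 | h1 | h1 | h1) | (h1 | h1 | h1 | h1)
    · exact absurd (h.inj h1) hij
    · exact absurd h1 (h.y_ne_leaf htf _ _ _)
    · exact absurd h1 (h.y_not_adj htf _ _)
    · exact absurd (h.eq_of_adj_leaf hsf h1.symm) hij
    · exact absurd h1.symm (h.y_ne_leaf htf _ _ _)
    · exact absurd (h.leaf_inj hsf h1).1 hij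
    · exact absurd (h.eq_of_adj_leaf hsf h1).symm hij
    · exact absurd h1 (h.not_adj _ _ _)
  · cases b <;> cases c <;> simp_all

/-- A variant of `Closed.mem_of_four` in which the four edges are listed. -/
lemma Closed.mem_of_list (hreg : ∀ v, G.degree v = 4) (hA : Closed G P ψ₀ A) {x y : V}
    (h : G.Adj x y) (hP : s(x, y) ∉ P) {a b c d : Sym2 V} (hab : a ≠ b) (hac : a ≠ c) (had : a ≠ d)
    (hbc : b ≠ c) (hbd : b ≠ d) (hcd : c ≠ d) (ha : a ∈ nbhd G s(x, y)) (hb : b ∈ nbhd G s(x, y))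
    (hc : c ∈ nbhd G s(x, y)) (hd : d ∈ nbhd G s(x, y)) (haA : a ∈ A) (hbA : b ∈ A) (hcA : c ∈ A)
    (hdA : d ∈ A ∨ d ∈ P ∧ ∃ d' ∈ nbhd G s(x, y) \ {a, b, c, d}, d' ∈ P ∧ ψ₀ d' = ψ₀ d) :
    s(x, y) ∈ A := by
  refine hA.mem_of_four hreg h hP {a, b, c, d} ?_ ?_ ?_
  · rw [Finset.card_insert_of_notMem, Finset.card_insert_of_notMem, Finset.card_pair hcd] <;>
      simp [*]
  · intro e he
    simp only [mem_insert, mem_singleton] at he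
    rcases he with rfl | rfl | rfl | rfl <;> assumption
  · intro e he
    rw [mem_insert, mem_insert, mem_insert, mem_singleton] at he
    rcases he with rfl | rfl | rfl | rfl
    · exact Or.inl haA
    · exact Or.inl hbA
    · exact Or.inl hcA
    · exact hdA

lemma IsConfig.full_center (hreg : ∀ v, G.degree v = 4) (htf : TriangleFree G)
    (h : IsConfig G v y l) (hA : Closed G (pattern y l) (patternColor y l) A) : Full G A v := by
  intro u hu
  have hP : s(v, u) ∉ pattern y l := not_mem_pattern h.center_not_mem
  have hmem : ∀ k b, s(y k, l k b) ∈ nbhd G s(v, u) := fun k b =>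
    mem_nbhd_edges.2 ⟨h.adj_leaf k b, fun heq => hP (mem_pattern.2 ⟨k, b, heq.symm⟩),
      Or.inl (Or.inr (Or.inr (Or.inl (h.adj k))))⟩
  set D : Finset (Sym2 V) :=
    (univ.filter fun p : Fin 3 × Bool => p.1 ≠ 0).image fun p => s(y p.1, l p.1 p.2)
  have hDn : D ⊆ nbhd G s(v, u) := by
    intro d hd
    obtain ⟨p, -, rfl⟩ := mem_image.1 hd
    exact hmem _ _
  have hDc : D.card = 4 := by
    rw [Finset.card_image_of_injective _ fun p q hpq => Prod.ext (h.edge_inj htf hpq).1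
      (h.edge_inj htf hpq).2]
    decide
  refine hA.mem_of_four hreg hu hP D hDc hDn fun d hd => Or.inr ?_
  obtain ⟨⟨k, b⟩, hk, rfl⟩ := mem_image.1 hd
  refine ⟨mem_pattern.2 ⟨k, b, rfl⟩, s(y 0, l 0 b), mem_sdiff.2 ⟨hmem 0 b, ?_⟩,
    mem_pattern.2 ⟨0, b, rfl⟩, by rw [h.patternColor_eq htf, h.patternColor_eq htf]⟩
  rw [mem_image]
  rintro ⟨⟨j, c⟩, hj, heq⟩
  exact (mem_filter.1 hj).2 (h.edge_inj htf heq).1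

end StrongEdge

namespace StrongEdge

open Finset

variable {V : Type*} [Fintype V] [DecidableEq V] {G : SimpleGraph V} [DecidableRel G.Adj]
  {v r : V} {y : Fin 3 → V} {l : Fin 3 → Bool → V} {A P : Finset (Sym2 V)} {ψ₀ : Sym2 V → Fin 21}

lemma Closed.mem_of_two_paths (hreg : ∀ v, G.degree v = 4) (hA : Closed G P ψ₀ A)
    {x p q p' q' : V} (hp : G.Adj x p) (hp' : G.Adj x p') (hpq : G.Adj p q) (hpq' : G.Adj p' q')
    (hpp' : p ≠ p') (hqx : q ≠ x) (hqx' : q' ≠ x) (hne : ¬ G.Adj p p') (hxp : s(x, p) ∈ A)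
    (hxp' : s(x, p') ∈ A) (hq : s(p, q) ∈ A) (hq' : s(p', q') ∈ A) {z : V} (hz : G.Adj x z)
    (hP : s(x, z) ∉ P) : s(x, z) ∈ A := by
  by_cases h1 : z = p
  · rwa [h1]
  by_cases h2 : z = p'
  · rwa [h2]
  have h3 := hp.ne
  have h4 := hp'.ne
  refine hA.mem_of_list hreg hz hP (a := s(x, p)) (b := s(x, p')) (c := s(p, q)) (d := s(p', q'))
    ?_ ?_ ?_ ?_ ?_ ?_ ?_ ?_ ?_ ?_ hxp hxp' hq (Or.inl hq')
  any_goals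
    clear hreg hA hxp hxp' hq hq' hP
    simp only [ne_eq, Sym2.eq_iff]
    grind
  all_goals
    rw [mem_nbhd_edges]
    clear hreg hA hxp hxp' hq hq' hP
    simp only [ne_eq, Sym2.eq_iff]
    grind

lemma IsConfig.mem_of_left (hreg : ∀ v, G.degree v = 4) (htf : TriangleFree G)
    (h : IsConfig G v y l) (hA : Closed G (pattern y l) (patternColor y l) A) {k : Fin 3} {z : V}
    (hz : G.Adj (y k) z) (hP : s(y k, z) ∉ pattern y l) : s(y k, z) ∈ A :=
  hA.mem_of_full hreg (h.full_center hreg htf hA) (h.adj k).symm hz hP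

lemma IsConfig.exists_pendant (hreg : ∀ v, G.degree v = 4) (htf : TriangleFree G)
    (h : IsConfig G v y l) (hA : Closed G (pattern y l) (patternColor y l) A) (k : Fin 3) :
    ∃ u, G.Adj (y k) u ∧ u ≠ v ∧ (∀ b, u ≠ l k b) ∧ s(y k, u) ∈ A := by
  obtain ⟨u, hu, hne⟩ := exists_fourth_neighbor hreg (y k) ![v, l k false, l k true]
  have huv : u ≠ v := hne 0
  have hul : ∀ b, u ≠ l k b := by
    rintro (_ | _)
    · exact hne 1
    · exact hne 2
  refine ⟨u, hu, huv, hul, h.mem_of_left hreg htf hA hu ?_⟩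
  rw [mem_pattern]
  rintro ⟨j, b, heq⟩
  rcases Sym2.eq_iff.1 heq with ⟨h1, h2⟩ | ⟨h1, -⟩
  · obtain rfl := h.inj h1
    exact hul b h2
  · exact h.y_ne_leaf htf k j b h1

lemma Full.of_reachAvoiding (hreg : ∀ v, G.degree v = 4)
    (hA : Closed G (pattern y l) (patternColor y l) A)
    (hr : r ∉ support y l) (hv : ReachAvoiding G (support y l) r v) (hf : Full G A v) {u : V}
    (hu : ReachAvoiding G (support y l) r u) : Full G A u := by
  have hstep : ∀ a b, G.Adj a b → b ∉ support y l → Full G A a → Full G A b :=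
    fun a b hab hb ha z hz => hA.mem_of_full hreg ha hab.symm hz (not_mem_pattern hb)
  have hfr : Full G A r := by
    clear hu
    induction hv using Relation.ReflTransGen.head_induction_on with
    | refl => exact hf
    | head hab hbc ih => exact hstep _ _ hab.1.symm hab.2.1 (ih hab.2.2)
  induction hu with
  | refl => exact hfr
  | tail hab hbc ih => exact hstep _ _ hbc.1 hbc.2.2 ih

lemma IsConfig.full_of_left_right (hreg : ∀ v, G.degree v = 4) (htf : TriangleFree G)
    (h : IsConfig G v y l) (hA : Closed G (pattern y l) (patternColor y l) A) {x w : V}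
    (hx : x ∉ support y l) (hxv : x ≠ v) (hwx : w ≠ x) {i j : Fin 3} {b : Bool}
    (hxi : G.Adj x (y i)) (hxj : G.Adj x (l j b)) (hw : G.Adj (l j b) w)
    (hwA : s(l j b, w) ∈ A) : Full G A x := by
  have hfv := h.full_center hreg htf hA
  have hij : i ≠ j := by
    rintro rfl
    exact htf _ _ _ hxi (h.adj_leaf i b) hxj
  have h1 : s(x, y i) ∈ A := by
    rw [Sym2.eq_swap]
    refine h.mem_of_left hreg htf hA hxi.symm ?_
    rw [Sym2.eq_swap]
    exact not_mem_pattern hx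
  have h2 := hfv _ (h.adj i)
  have h3 := hfv _ (h.adj j)
  have hyy : y i ≠ y j := fun heq => hij (h.inj heq)
  have hyl := h.y_ne_leaf htf i j b
  have hvl := h.leaf_ne j b
  have hai := h.adj i
  have haj := h.adj j
  have hal := h.adj_leaf j b
  have hxyj : x ≠ y j := fun heq => hx (heq ▸ mem_support_left j)
  have hnij : ¬ G.Adj (y i) (l j b) := fun hadj =>
    htf x (y i) (l j b) hxi hadj hxj
  have h4 : s(x, l j b) ∈ A := by
    refine hA.mem_of_list hreg hxj (not_mem_pattern hx) (a := s(x, y i)) (b := s(v, y i))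
      (c := s(v, y j)) (d := s(l j b, w)) ?_ ?_ ?_ ?_ ?_ ?_ ?_ ?_ ?_ ?_ h1 h2 h3 (Or.inl hwA)
    any_goals
      clear hreg hA hfv h1 h2 h3 hwA h htf hx
      have := hxi.ne
      have := hxj.ne
      have := hai.ne
      have := haj.ne
      have := hal.ne
      simp only [ne_eq, Sym2.eq_iff]
      grind
    all_goals
      rw [mem_nbhd_edges]
      have := hxi.ne
      have := hxj.ne
      have := hai.ne
      have := haj.ne
      have := hal.ne
      clear hreg hA hfv h1 h2 h3 hwA h htf hx
      simp only [ne_eq, Sym2.eq_iff]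
      grind [SimpleGraph.Adj.symm]
  intro z hz
  rw [Sym2.eq_swap] at h2
  exact hA.mem_of_two_paths hreg hxi hxj hai.symm hw hyl hxv.symm hwx hnij h1 h4 h2 hwA hz
    (not_mem_pattern hx)

lemma IsConfig.mem_of_right_right (hreg : ∀ v, G.degree v = 4) (htf : TriangleFree G)
    (hsf : SquareFree G) (h : IsConfig G v y l)
    (hA : Closed G (pattern y l) (patternColor y l) A) {x w : V}
    (hx : x ∉ support y l) (hxv : x ≠ v) (hwW : w ∉ support y l) (hwx : w ≠ x) {i j : Fin 3}
    {b c : Bool} (hij : i ≠ j) (hxi : G.Adj x (l i b)) (hxj : G.Adj x (l j c))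
    (hw : G.Adj (l i b) w) (hwA : s(l i b, w) ∈ A) : s(x, l i b) ∈ A := by
  obtain ⟨u, hu, huv, hul, huA⟩ := h.exists_pendant hreg htf hA i
  have h2 := h.full_center hreg htf hA _ (h.adj i)
  have hyy : y i ≠ y j := fun heq => hij (h.inj heq)
  have hyl := h.y_ne_leaf htf
  have hvl := h.leaf_ne
  have hai := h.adj i
  have haj := h.adj j
  have hal := h.adj_leaf
  have hxy : ∀ k, x ≠ y k := fun k heq => hx (heq ▸ mem_support_left k)
  have hwy : ∀ k, w ≠ y k := fun k heq => hwW (heq ▸ mem_support_left k)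
  have hll : ∀ b c, l i b ≠ l j c := fun b c heq => hij (h.leaf_inj hsf heq).1
  have hmP : s(y j, l j c) ∈ pattern y l := mem_pattern.2 ⟨j, c, rfl⟩
  have hmP' : s(y i, l i c) ∈ pattern y l := mem_pattern.2 ⟨i, c, rfl⟩
  have hcol : patternColor y l s(y i, l i c) = patternColor y l s(y j, l j c) := by
    rw [h.patternColor_eq htf, h.patternColor_eq htf]
  have hxl : ∀ k b, x ≠ l k b := fun k b heq => hx (heq ▸ mem_support_right k b)
  refine hA.mem_of_list hreg hxi (not_mem_pattern hx) (a := s(v, y i)) (b := s(y i, u))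
    (c := s(l i b, w)) (d := s(y j, l j c)) ?_ ?_ ?_ ?_ ?_ ?_ ?_ ?_ ?_ ?_ h2 huA hwA
    (Or.inr ⟨hmP, s(y i, l i c), ?_, hmP', hcol⟩)
  any_goals
    clear hreg hA h2 hwA h htf hx hsf hmP hmP' hcol
    have := hai.ne
    have := haj.ne
    simp only [ne_eq, Sym2.eq_iff]
    grind
  any_goals
    rw [mem_nbhd_edges]
    clear hreg hA h2 hwA h htf hx hsf hmP hmP' hcol
    have := hai.ne
    have := haj.ne
    simp only [ne_eq, Sym2.eq_iff]
    grind [SimpleGraph.Adj.symm]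
  rw [mem_sdiff, mem_nbhd_edges]
  simp only [mem_insert, mem_singleton]
  clear hreg hA h2 hwA h htf hx hsf hmP hmP' hcol
  have := hai.ne
  have := haj.ne
  simp only [ne_eq, Sym2.eq_iff]
  grind [SimpleGraph.Adj.symm]

lemma IsConfig.mem_of_leaf_leaf (hreg : ∀ v, G.degree v = 4) (htf : TriangleFree G)
    (h : IsConfig G v y l) (hA : Closed G (pattern y l) (patternColor y l) A) {i j : Fin 3}
    {b c : Bool} (hadj : G.Adj (l i b) (l j c)) : s(l i b, l j c) ∈ A := by
  have hij : i ≠ j := by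
    rintro rfl
    exact htf _ _ _ (h.adj_leaf i b) hadj (h.adj_leaf i c)
  obtain ⟨u, hu, huv, hul, huA⟩ := h.exists_pendant hreg htf hA i
  obtain ⟨u', hu', huv', hul', huA'⟩ := h.exists_pendant hreg htf hA j
  have h2 := h.full_center hreg htf hA _ (h.adj i)
  have h3 := h.full_center hreg htf hA _ (h.adj j)
  have hyy : y i ≠ y j := fun heq => hij (h.inj heq)
  have hyl := h.y_ne_leaf htf
  have hvl := h.leaf_ne
  have hai := h.adj i
  have haj := h.adj j
  have hal := h.adj_leaf i b
  have hal' := h.adj_leaf j c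
  have hny := h.y_not_adj htf i j
  have hP : s(l i b, l j c) ∉ pattern y l := by
    rw [mem_pattern]
    rintro ⟨k, d, heq⟩
    rcases Sym2.eq_iff.1 heq with ⟨h1, -⟩ | ⟨-, h1⟩ <;> exact hyl _ _ _ h1.symm
  refine hA.mem_of_list hreg hadj hP (a := s(v, y i)) (b := s(y i, u))
    (c := s(v, y j)) (d := s(y j, u')) ?_ ?_ ?_ ?_ ?_ ?_ ?_ ?_ ?_ ?_ h2 huA h3 (Or.inl huA')
  any_goals
    clear hreg hA h2 h3 huA huA' h htf hP
    have := hai.ne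
    have := haj.ne
    simp only [ne_eq, Sym2.eq_iff]
    grind
  all_goals
    rw [mem_nbhd_edges]
    clear hreg hA h2 h3 huA huA' h htf hP
    have := hai.ne
    have := haj.ne
    simp only [ne_eq, Sym2.eq_iff]
    grind [SimpleGraph.Adj.symm]

lemma IsMaxConfig.full (hreg : ∀ v, G.degree v = 4) (hG : G.Connected) (htf : TriangleFree G)
    (hsf : SquareFree G) (h : IsMaxConfig G v y l r)
    (hA : Closed G (pattern y l) (patternColor y l) A) {x : V} (hx : x ∉ support y l) :
    Full G A x := by
  have hc : IsConfig G v y l := h.1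
  have hv := h.reach_center hreg hG htf hsf
  have hreach : ∀ {u}, ReachAvoiding G (support y l) r u → Full G A u := fun hu =>
    Full.of_reachAvoiding hreg hA h.2.1 hv (hc.full_center hreg htf hA) hu
  by_cases hxC : ReachAvoiding G (support y l) r x
  · exact hreach hxC
  obtain ⟨p, p', w, w', hpp, hxp, hxp', hp, hp', hw, hwC, hw', hwC'⟩ :=
    h.exists_two_neighbors hreg hG htf hsf hx hxC
  have hne : ∀ {u}, ReachAvoiding G (support y l) r u → u ≠ x := by
    rintro u hu rfl
    exact hxC hu
  have hpw : s(p, w) ∈ A := by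
    rw [Sym2.eq_swap]
    exact hreach hwC _ hw.symm
  have hpw' : s(p', w') ∈ A := by
    rw [Sym2.eq_swap]
    exact hreach hwC' _ hw'.symm
  have hvx := (hne hv).symm
  rcases mem_support.1 hp with ⟨i, rfl⟩ | ⟨i, b, rfl⟩ <;>
    rcases mem_support.1 hp' with ⟨j, rfl⟩ | ⟨j, c, rfl⟩
  · exact absurd (hsf x v _ _ hxp (hc.adj i) hxp' (hc.adj j) hvx) hpp
  · exact hc.full_of_left_right hreg htf hA hx hvx (hne hwC') hxp hxp' hw' hpw'
  · exact hc.full_of_left_right hreg htf hA hx hvx (hne hwC) hxp' hxp hw hpw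
  · have hij : i ≠ j := by
      rintro rfl
      refine hpp (hsf x (y i) _ _ hxp (hc.adj_leaf i b) hxp' (hc.adj_leaf i c) ?_)
      rintro rfl
      exact hx (mem_support_left i)
    have h1 := hc.mem_of_right_right hreg htf hsf hA hx hvx (hwC.not_mem h.2.1) (hne hwC) hij hxp
      hxp' hw hpw
    have h2 := hc.mem_of_right_right hreg htf hsf hA hx hvx (hwC'.not_mem h.2.1) (hne hwC')
      hij.symm hxp' hxp hw' hpw'
    intro z hz
    exact hA.mem_of_two_paths hreg hxp hxp' hw hw' hpp (hne hwC) (hne hwC')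
      (fun hadj => htf _ _ _ hxp hadj hxp') h1 h2 hpw hpw' hz (not_mem_pattern hx)

theorem exists_validOn_of_squareFree (hreg : ∀ v, G.degree v = 4) (hG : G.Connected)
    (htf : TriangleFree G) (hsf : SquareFree G) : ∃ ψ, ValidOn G G.edgeFinset ψ := by
  obtain ⟨v₀⟩ := hG.nonempty
  obtain ⟨v, y, l, r, h⟩ := exists_isMaxConfig hreg htf hsf v₀
  have hc : IsConfig G v y l := h.1
  obtain ⟨ψ, hψ⟩ := exists_validOn_of_closed (G := G) (pattern y l) ∅ (patternColor y l)
    (hc.validOn htf hsf) (by simp) (fun A _ hA e he hP => by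
      induction e with | _ a b =>
      rw [SimpleGraph.mem_edgeSet] at he
      by_cases ha : a ∉ support y l
      · exact h.full hreg hG htf hsf hA ha b he
      by_cases hb : b ∉ support y l
      · rw [Sym2.eq_swap]
        exact h.full hreg hG htf hsf hA hb a he.symm
      rw [not_not, mem_support] at ha hb
      rcases ha with ⟨i, rfl⟩ | ⟨i, b', rfl⟩
      · exact hc.mem_of_left hreg htf hA he hP
      rcases hb with ⟨j, rfl⟩ | ⟨j, c, rfl⟩
      · rw [Sym2.eq_swap] at hP ⊢
        exact hc.mem_of_left hreg htf hA he.symm hP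
      · exact hc.mem_of_leaf_leaf hreg htf hA he)
  exact ⟨ψ, by simpa using hψ⟩

theorem exists_validOn_of_connected (hreg : ∀ v, G.degree v = 4) (hG : G.Connected) :
    ∃ ψ, ValidOn G G.edgeFinset ψ := by
  by_cases htf : TriangleFree G
  · by_cases hs : ∃ x y z w, IsSquare G x y z w
    · obtain ⟨x, y, z, w, h⟩ := hs
      exact h.exists_validOn_edgeFinset hreg hG htf
    · push Not at hs
      exact exists_validOn_of_squareFree hreg hG htf (squareFree_of_forall_not_isSquare hs)
  · simp only [TriangleFree, not_forall, not_not] at htf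
    obtain ⟨a, b, c, hab, hbc, hac⟩ := htf
    exact exists_validOn_of_triangle hreg hG hab hac hbc

end StrongEdge

namespace StrongEdge

lemma degree_toSimpleGraph {V : Type*} [Fintype V] {G : SimpleGraph V} [DecidableRel G.Adj]
    (c : G.ConnectedComponent) [Fintype c] [DecidableRel c.toSimpleGraph.Adj] (u : c) :
    c.toSimpleGraph.degree u = G.degree u := by
  rw [← SimpleGraph.card_neighborFinset_eq_degree, ← SimpleGraph.card_neighborFinset_eq_degree]
  refine Finset.card_bij (fun w _ => (w : V)) ?_ (fun _ _ _ _ h => Subtype.ext h) ?_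
  · intro w hw
    rw [SimpleGraph.mem_neighborFinset] at hw ⊢
    exact (c.toSimpleGraph_adj u.2 w.2).1 hw
  · intro w hw
    rw [SimpleGraph.mem_neighborFinset] at hw
    have hwc : w ∈ c := c.mem_supp_of_adj_mem_supp u.2 hw
    refine ⟨⟨w, hwc⟩, ?_, rfl⟩
    rw [SimpleGraph.mem_neighborFinset]
    exact (c.toSimpleGraph_adj u.2 hwc).2 hw

/-- Strong edge-colorability of a connected component, in terms of the edges of `G`. -/
lemma exists_coloring_component {V : Type*} [Fintype V] {G : SimpleGraph V} [DecidableRel G.Adj]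
    (hreg : ∀ v, G.degree v = 4) (c : G.ConnectedComponent) :
    ∃ ψ : Sym2 V → Fin 21, ∀ e ∈ G.edgeSet, ∀ f ∈ G.edgeSet, (∀ u ∈ e, u ∈ c) → (∀ u ∈ f, u ∈ c) →
      e ≠ f → StrongConflict G e f → ψ e ≠ ψ f := by
  classical
  obtain ⟨ψ, hψ⟩ := exists_validOn_of_connected (G := c.toSimpleGraph)
    (fun u => (degree_toSimpleGraph c u).trans (hreg u)) c.connected_toSimpleGraph
  have hinj : Function.Injective (Sym2.map ((↑) : c → V)) :=
    Sym2.map.injective Subtype.val_injective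
  have hlift : ∀ e ∈ G.edgeSet, (∀ u ∈ e, u ∈ c) →
      ∃ e' ∈ c.toSimpleGraph.edgeSet, e'.map ((↑) : c → V) = e := by
    intro e he hc
    induction e with | _ a b =>
    have ha : a ∈ c := hc a (by simp)
    have hb : b ∈ c := hc b (by simp)
    exact ⟨s(⟨a, ha⟩, ⟨b, hb⟩), (c.toSimpleGraph_adj ha hb).2 he, rfl⟩
  refine ⟨Function.extend (Sym2.map ((↑) : c → V)) ψ 0, ?_⟩
  intro e he f hf hec hfc hne hconf
  obtain ⟨e', he', rfl⟩ := hlift e he hec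
  obtain ⟨f', hf', rfl⟩ := hlift f hf hfc
  rw [hinj.extend_apply, hinj.extend_apply]
  refine hψ e' (by simpa using he') f' (by simpa using hf')
    (mem_nbhd.2 ⟨hf', fun h => hne (by rw [h]), ?_⟩)
  simp only [StrongConflict, Sym2.mem_map] at hconf
  rcases hconf with ⟨_, ⟨u, hu, rfl⟩, w, hw, hwu⟩ | ⟨_, _, ⟨u, hu, rfl⟩, ⟨w, hw, rfl⟩, hadj⟩
  · exact Or.inl ⟨u, hu, Subtype.ext hwu ▸ hw⟩
  · exact Or.inr ⟨u, w, hu, hw, (c.toSimpleGraph_adj u.2 w.2).2 hadj⟩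

lemma connectedComponentMk_eq_of_mem {V : Type*} {G : SimpleGraph V} {e : Sym2 V}
    (he : e ∈ G.edgeSet) {u w : V} (hu : u ∈ e) (hw : w ∈ e) :
    G.connectedComponentMk u = G.connectedComponentMk w := by
  by_cases huw : u = w
  · rw [huw]
  · rw [(Sym2.mem_and_mem_iff huw).1 ⟨hu, hw⟩] at he
    exact SimpleGraph.ConnectedComponent.sound (SimpleGraph.Adj.reachable he)

end StrongEdge

/-- Every 4-regular simple graph containing a 3-cycle has a strong
edge-coloring with at most 21 colors. -/
theorem strong_edge_coloring_4regular_triangle {V : Type*} [Fintype V]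
    (G : SimpleGraph V) [DecidableRel G.Adj]
    (hreg : ∀ v, G.degree v = 4)
    (htri : ∃ (v : V) (c : G.Walk v v), c.IsCycle ∧ c.length = 3) :
    ∃ C : G.edgeSet → Fin 21, IsStrongEdgeColoring G C := by
  choose ψ hψ using fun c : G.ConnectedComponent => StrongEdge.exists_coloring_component hreg c
  have key : ∀ e ∈ G.edgeSet, ∀ u ∈ e,
      G.connectedComponentMk u = G.connectedComponentMk (Quot.out e).1 := fun e he u hu =>
    StrongEdge.connectedComponentMk_eq_of_mem he hu (Sym2.out_fst_mem e)
  refine ⟨fun e => ψ (G.connectedComponentMk (Quot.out (e : Sym2 V)).1) e, ?_⟩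
  rintro ⟨e, he⟩ ⟨f, hf⟩ hne hconf
  have hcomp : G.connectedComponentMk (Quot.out e).1 = G.connectedComponentMk (Quot.out f).1 := by
    rcases hconf with ⟨u, hu, hu'⟩ | ⟨u, w, hu, hw, hadj⟩
    · rw [← key e he u hu, ← key f hf u hu']
    · rw [← key e he u hu, ← key f hf w hw]
      exact SimpleGraph.ConnectedComponent.sound hadj.reachable
  dsimp only
  rw [← hcomp]
  exact hψ _ e he f hf (key e he) (fun u hu => (key f hf u hu).trans hcomp.symm)
    (fun h => hne (Subtype.ext h)) hconf
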